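/- In the braid group B_{n+1}, the pair (H, G₁) is a Dehornoy structure: PP ⊆ P, G₁PG₁ ⊆ P, and G is the disjoint union of P, P⁻¹ and G₁. -/

import Mathlib

namespace GarsideOrder

variable {G : Type*} [Group G]

/-- `a ≤_R b` iff `b * a⁻¹ ∈ M`. -/
def leR (M : Submonoid G) (a b : G) : Prop := b * a⁻¹ ∈ M

/-- `a ≤_L b` iff `a⁻¹ * b ∈ M`. -/
def leL (M : Submonoid G) (a b : G) : Prop := a⁻¹ * b ∈ M

/-- Right divisors (in `M`) of `a`. -/
def DivR (M : Submonoid G) (a : G) : Set G := {b : G | b ∈ M ∧ leR M b a}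

/-- Left divisors (in `M`) of `a`. -/
def DivL (M : Submonoid G) (a : G) : Set G := {b : G | b ∈ M ∧ leL M b a}

/-- `a` is balanced if its sets of right and left divisors coincide. -/
def Balanced (M : Submonoid G) (a : G) : Prop := DivR M a = DivL M a

open Classical in
/-- The `N`-tail of `a`: the unique `b ∈ N` having the same right divisors lying in `N`
as `a` (w.r.t. the divisibility of the ambient monoid `M`). -/
noncomputable def tail (M N : Submonoid G) (a : G) : G :=
  if h : ∃ b : G, b ∈ N ∧
      {c : G | c ∈ N ∧ leR M c a} = {c : G | c ∈ N ∧ leR M c b} then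
    h.choose
  else 1

/-- Iterated stripping of alternating tails: first the `M₁`-tail, then the `N`-tail, etc. -/
noncomputable def strip (M M₁ N : Submonoid G) : ℕ → G → G
  | 0, a => a
  | i + 1, a =>
      strip M M₁ N i a *
        (tail M (if i % 2 = 0 then M₁ else N) (strip M M₁ N i a))⁻¹

/-- The breadth of `a`: the length of the alternating form of `a`, i.e. the least `p ≥ 1`
such that stripping alternating tails `p` times reaches `1`. -/
noncomputable def bh (M M₁ N : Submonoid G) (a : G) : ℕ :=
  sInf {p : ℕ | 1 ≤ p ∧ strip M M₁ N p a = 1}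

/-- The depth of `a`: `(bh a - 1)/2` if `bh a` is odd, `bh a / 2` if `bh a` is even;
in both cases this is `bh a / 2` with natural division. -/
noncomputable def dpt (M M₁ N : Submonoid G) (a : G) : ℕ := bh M M₁ N a / 2

/-- `a ∈ M` is unmovable if `Δ` does not right-divide it. -/
def Unmovable (M : Submonoid G) (Δ a : G) : Prop := a ∈ M ∧ ¬ leR M Δ a

/-- `α` is `(H, G₁)`-negative: its `Δ`-form is `a Δ^{-k}` with `k ≥ 1` and
`dpt a < dpt (Δ^k)`. -/
def Negative (M M₁ N : Submonoid G) (Δ : G) (α : G) : Prop :=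
  ∃ a : G, ∃ k : ℕ, Unmovable M Δ a ∧ 1 ≤ k ∧ α = a * (Δ ^ k)⁻¹ ∧
    dpt M M₁ N a < dpt M M₁ N (Δ ^ k)

/-- `α` is `(H, G₁)`-positive if `α⁻¹` is `(H, G₁)`-negative. -/
def Positive (M M₁ N : Submonoid G) (Δ : G) (α : G) : Prop :=
  Negative M M₁ N Δ α⁻¹

/-- The set `Θ` of theta elements `θ^k a₀`, `k ≥ 1`, `a₀ ∈ M₁`. -/
def thetaSet (M₁ : Submonoid G) (θ : G) : Set G :=
  {x : G | ∃ k : ℕ, 1 ≤ k ∧ ∃ a₀ ∈ M₁, x = θ ^ k * a₀}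

/-- `Θ̄ = Θ ∪ M₁`. -/
def thetaBar (M₁ : Submonoid G) (θ : G) : Set G := thetaSet M₁ θ ∪ (M₁ : Set G)

/-- Condition A with constant `ζ`: `dpt (Δ^k) = ζ k + 1` for all `k ≥ 1`. -/
def CondA (M M₁ N : Submonoid G) (Δ : G) (ζ : ℕ) : Prop :=
  ∀ k : ℕ, 1 ≤ k → dpt M M₁ N (Δ ^ k) = ζ * k + 1

/-- Condition B with constant `ζ`. -/
def CondB (M M₁ N : Submonoid G) (Δ θ : G) (ζ : ℕ) : Prop :=
  ∀ a b c : G, ∀ t : ℤ,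
    Unmovable M Δ a → Unmovable M Δ b →
    ¬(a ∈ thetaBar M₁ θ ∧ b ∈ thetaBar M₁ θ) →
    Unmovable M Δ c → a * b = c * Δ ^ t →
    ∃ ε : ℕ, ε ≤ 1 ∧
      (dpt M M₁ N c : ℤ) =
        (dpt M M₁ N a : ℤ) + (dpt M M₁ N b : ℤ) - (ζ : ℤ) * t - (ε : ℤ) ∧
      ((a ∈ thetaSet M₁ θ ∨ b ∈ thetaSet M₁ θ ∨ c ∈ M₁) → ε = 1)

/-- A Garside structure with group of fractions the subgroup `car`. -/
structure IsGarsideOn (car : Subgroup G) (M : Submonoid G) (Δ : G) : Prop where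
  M_sub : (M : Set G) ⊆ (car : Set G)
  delta_mem : Δ ∈ M
  units_trivial : ∀ x : G, x ∈ M → x⁻¹ ∈ M → x = 1
  noetherian : ∀ a ∈ M, ∃ n : ℕ, 1 ≤ n ∧ ∀ l : List G,
      (∀ x ∈ l, x ∈ M ∧ x ≠ 1) → l.prod = a → l.length ≤ n
  balanced : Balanced M Δ
  div_finite : (DivR M Δ).Finite
  div_gen_monoid : Submonoid.closure (DivR M Δ) = M
  div_gen_group : Subgroup.closure (DivR M Δ) = car
  meet : ∀ a ∈ car, ∀ b ∈ car, ∃ c ∈ car, leR M c a ∧ leR M c b ∧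
      ∀ d ∈ car, leR M d a → leR M d b → leR M d c
  join : ∀ a ∈ car, ∀ b ∈ car, ∃ c ∈ car, leR M a c ∧ leR M b c ∧
      ∀ d ∈ car, leR M a d → leR M b d → leR M c d

/-- The parabolic submonoid determined by `δ`: the submonoid generated by `Div(δ)`. -/
def parM (M : Submonoid G) (δ : G) : Submonoid G := Submonoid.closure (DivR M δ)

/-- The parabolic subgroup determined by `δ`: the subgroup generated by `Div(δ)`. -/
def parG (M : Submonoid G) (δ : G) : Subgroup G := Subgroup.closure (DivR M δ)

/-- `δ` determines a parabolic substructure of `(G, M, Δ)`. -/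
structure IsParabolic (M : Submonoid G) (Δ δ : G) : Prop where
  mem : δ ∈ M
  balanced : Balanced M δ
  div_eq : DivR M δ = DivR M Δ ∩ (parM M δ : Set G)

/-- The setting of Section 3: a Garside structure `(car, M, Δ)` together with two
parabolic substructures `(H, N, Λ)` (given by `lam`) and `(G₁, M₁, Δ₁)` (given by `δ1`),
with `N ≠ M`, `M₁ ≠ M`, `N ∪ M₁` generating `M`, `Δ` central, `Δ₁` central in `G₁`. -/
structure Setting (G : Type*) [Group G] where
  car : Subgroup G
  M : Submonoid G
  Δ : G
  δ1 : G
  lam : G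
  garside : IsGarsideOn car M Δ
  par1 : IsParabolic M Δ δ1
  parH : IsParabolic M Δ lam
  N_ne : parM M lam ≠ M
  M1_ne : parM M δ1 ≠ M
  unionGen : Submonoid.closure ((parM M lam : Set G) ∪ (parM M δ1 : Set G)) = M
  delta_central : ∀ g ∈ car, Δ * g = g * Δ
  delta1_central : ∀ g ∈ parG M δ1, δ1 * g = g * δ1

namespace Setting

variable (S : Setting G)

/-- The parabolic submonoid `M₁`. -/
def M₁ : Submonoid G := parM S.M S.δ1

/-- The parabolic submonoid `N`. -/
def Nsub : Submonoid G := parM S.M S.lam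

/-- The parabolic subgroup `G₁`. -/
def G₁ : Subgroup G := parG S.M S.δ1

/-- `θ = Δ Δ₁⁻¹`. -/
def theta : G := S.Δ * S.δ1⁻¹

/-- The set of `(H, G₁)`-negative elements. -/
def Neg : Set G := {α : G | Negative S.M S.M₁ S.Nsub S.Δ α}

/-- The set of `(H, G₁)`-positive elements. -/
def Pos : Set G := {α : G | α⁻¹ ∈ S.Neg}

/-- Condition A. -/
def condA (ζ : ℕ) : Prop := CondA S.M S.M₁ S.Nsub S.Δ ζ

/-- Condition B. -/
def condB (ζ : ℕ) : Prop := CondB S.M S.M₁ S.Nsub S.Δ S.theta ζ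

/-- `(H, G₁)` is a Dehornoy structure: `PP ⊆ P`, `G₁ P G₁ ⊆ P`, and the group is the
disjoint union of `P`, `P⁻¹` and `G₁`. -/
def IsDehornoy : Prop :=
  (∀ α ∈ S.Pos, ∀ β ∈ S.Pos, α * β ∈ S.Pos) ∧
  (∀ g₁ ∈ S.G₁, ∀ α ∈ S.Pos, ∀ g₂ ∈ S.G₁, g₁ * α * g₂ ∈ S.Pos) ∧
  (∀ α ∈ S.car, α ∈ S.Pos ∨ α ∈ S.Neg ∨ α ∈ S.G₁) ∧
  (∀ α : G, ¬(α ∈ S.Pos ∧ α ∈ S.Neg)) ∧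
  (∀ α : G, ¬(α ∈ S.Pos ∧ α ∈ S.G₁)) ∧
  (∀ α : G, ¬(α ∈ S.Neg ∧ α ∈ S.G₁))

end Setting

end GarsideOrder


namespace BraidOrder

open GarsideOrder

/-- The braid relations on `n` generators `σ_0, …, σ_{n-1}` (representing `s_1, …, s_n`). -/
def braidRel (n : ℕ) : Set (FreeGroup (Fin n)) :=
  {r | ∃ i j : Fin n,
      ((i : ℕ) + 1 = (j : ℕ) ∧
        r = FreeGroup.of i * FreeGroup.of j * FreeGroup.of i *
            (FreeGroup.of j * FreeGroup.of i * FreeGroup.of j)⁻¹) ∨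
      ((i : ℕ) + 2 ≤ (j : ℕ) ∧
        r = FreeGroup.of i * FreeGroup.of j * (FreeGroup.of j * FreeGroup.of i)⁻¹)}

/-- The braid group `B_{n+1}` on `n+1` strands, presented with `n` generators. -/
abbrev Braid (n : ℕ) := PresentedGroup (braidRel n)

/-- `gen n i` is the generator `s_{i+1}` of `B_{n+1}` (for `i < n`). -/
def gen (n i : ℕ) : Braid n :=
  if h : i < n then PresentedGroup.of ⟨i, h⟩ else 1

/-- The product `gen a * gen (a+1) * ⋯ * gen (b-1)`, i.e. `s_{a+1} s_{a+2} ⋯ s_b`. -/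
def seg (n a b : ℕ) : Braid n := (((List.range b).drop a).map (gen n)).prod

/-- The product `gen (b-1) * ⋯ * gen (a+1) * gen a`, i.e. `s_b ⋯ s_{a+2} s_{a+1}`. -/
def segRev (n a b : ℕ) : Braid n := ((((List.range b).drop a).reverse).map (gen n)).prod

/-- The positive braid monoid `B_{n+1}^+`. -/
def Mb (n : ℕ) : Submonoid (Braid n) :=
  Submonoid.closure {x : Braid n | ∃ i : ℕ, i < n ∧ x = gen n i}

/-- The submonoid generated by `s_2, …, s_n`. -/
def M₁b (n : ℕ) : Submonoid (Braid n) :=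
  Submonoid.closure {x : Braid n | ∃ i : ℕ, 1 ≤ i ∧ i < n ∧ x = gen n i}

/-- The submonoid generated by `s_1, …, s_{n-1}`. -/
def Nb (n : ℕ) : Submonoid (Braid n) :=
  Submonoid.closure {x : Braid n | ∃ i : ℕ, i + 1 < n ∧ x = gen n i}

/-- The subgroup generated by `s_2, …, s_n`. -/
def G₁b (n : ℕ) : Subgroup (Braid n) :=
  Subgroup.closure {x : Braid n | ∃ i : ℕ, 1 ≤ i ∧ i < n ∧ x = gen n i}

/-- The subgroup generated by `s_1, …, s_{n-1}`. -/
def Hb (n : ℕ) : Subgroup (Braid n) :=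
  Subgroup.closure {x : Braid n | ∃ i : ℕ, i + 1 < n ∧ x = gen n i}

/-- The Garside element `Δ = (s_1 s_2 ⋯ s_n)^{n+1}`. -/
def Δb (n : ℕ) : Braid n := seg n 0 n ^ (n + 1)

/-- `Δ₁ = (s_2 ⋯ s_n)^n`. -/
def Δ₁b (n : ℕ) : Braid n := seg n 1 n ^ n

/-- `Λ = (s_1 ⋯ s_{n-1})^n`. -/
def Λb (n : ℕ) : Braid n := seg n 0 (n - 1) ^ n

/-- `θ = s_1 ⋯ s_{n-1} s_n² s_{n-1} ⋯ s_1` as an explicit word. -/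
def thetaWordb (n : ℕ) : Braid n := seg n 0 n * segRev n 0 n

end BraidOrder

/-- `s` satisfies the braid relations of `B_{n+1}` in a monoid (far commutation is required for
all indices). -/
structure BraidSeq {T : Type*} [Monoid T] (n : ℕ) (s : ℕ → T) : Prop where
  braid : ∀ i, i + 1 < n → s i * s (i + 1) * s i = s (i + 1) * s i * s (i + 1)
  comm : ∀ i j, i + 2 ≤ j → s i * s j = s j * s i

/-- The ascending product `s a * s (a+1) * ⋯ * s (a+k-1)`. -/
def up {T : Type*} [Monoid T] (s : ℕ → T) (a : ℕ) : ℕ → T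
  | 0 => 1
  | k + 1 => up s a k * s (a + k)

/-- The descending product `s (a+k-1) * ⋯ * s (a+1) * s a`. -/
def dn {T : Type*} [Monoid T] (s : ℕ → T) (a : ℕ) : ℕ → T
  | 0 => 1
  | k + 1 => s (a + k) * dn s a k

section Monoid

variable {T : Type*} [Monoid T] {n : ℕ} {s : ℕ → T}

@[simp] lemma up_zero (a : ℕ) : up s a 0 = 1 := rfl

@[simp] lemma dn_zero (a : ℕ) : dn s a 0 = 1 := rfl

lemma up_succ (a k : ℕ) : up s a (k + 1) = up s a k * s (a + k) := rfl

lemma dn_succ (a k : ℕ) : dn s a (k + 1) = s (a + k) * dn s a k := rfl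

lemma up_succ' (a k : ℕ) : up s a (k + 1) = s a * up s (a + 1) k := by
  induction k with
  | zero => simp [up_succ]
  | succ k ih => rw [up_succ, ih, up_succ, mul_assoc, show a + (k + 1) = a + 1 + k by ring]

lemma dn_succ' (a k : ℕ) : dn s a (k + 1) = dn s (a + 1) k * s a := by
  induction k with
  | zero => simp [dn_succ]
  | succ k ih => rw [dn_succ, ih, dn_succ, ← mul_assoc, show a + (k + 1) = a + 1 + k by ring]

lemma dn_add (a k l : ℕ) : dn s a (k + l) = dn s (a + k) l * dn s a k := by
  induction l with
  | zero => simp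
  | succ l ih => rw [← add_assoc, dn_succ, ih, dn_succ, mul_assoc, add_assoc]

lemma up_mem {N : Submonoid T} {a : ℕ} : ∀ {k : ℕ}, (∀ i, a ≤ i → i < a + k → s i ∈ N) →
    up s a k ∈ N
  | 0, _ => N.one_mem
  | k + 1, h => N.mul_mem (up_mem fun i h1 h2 => h i h1 (by omega)) (h _ (by omega) (by omega))

lemma dn_mem {N : Submonoid T} {a : ℕ} : ∀ {k : ℕ}, (∀ i, a ≤ i → i < a + k → s i ∈ N) →
    dn s a k ∈ N
  | 0, _ => N.one_mem
  | k + 1, h => N.mul_mem (h _ (by omega) (by omega)) (dn_mem fun i h1 h2 => h i h1 (by omega))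

namespace BraidSeq

lemma far (hs : BraidSeq n s) {i j : ℕ} (h : i + 2 ≤ j ∨ j + 2 ≤ i) : s i * s j = s j * s i := by
  rcases h with h | h
  · exact hs.comm i j h
  · exact (hs.comm j i h).symm

lemma commute_up (hs : BraidSeq n s) {i a : ℕ} :
    ∀ {k : ℕ}, (i + 2 ≤ a ∨ a + k + 1 ≤ i) → Commute (s i) (up s a k)
  | 0, _ => Commute.one_right _
  | _ + 1, h => (hs.commute_up (by omega)).mul_right (hs.far (by omega))

lemma commute_dn (hs : BraidSeq n s) {i a : ℕ} :
    ∀ {k : ℕ}, (i + 2 ≤ a ∨ a + k + 1 ≤ i) → Commute (s i) (dn s a k)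
  | 0, _ => Commute.one_right _
  | _ + 1, h => Commute.mul_right (hs.far (by omega)) (hs.commute_dn (by omega))

lemma up_mul (hs : BraidSeq n s) {a i k : ℕ} (h1 : a ≤ i) (h2 : i + 1 < a + k) (h3 : i + 1 < n) :
    up s a k * s i = s (i + 1) * up s a k := by
  induction k with
  | zero => omega
  | succ k ih =>
    rcases Nat.lt_or_ge (i + 1) (a + k) with h | h
    · rw [up_succ, mul_assoc, hs.far (i := a + k) (j := i) (by omega), ← mul_assoc, ih h, mul_assoc]
    · obtain ⟨l, rfl⟩ : ∃ l, k = l + 1 := ⟨k - 1, by omega⟩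
      obtain rfl : i = a + l := by omega
      rw [up_succ, up_succ, show a + (l + 1) = a + l + 1 by ring]
      have := (hs.commute_up (i := a + l + 1) (a := a) (k := l) (by omega)).eq
      rw [← mul_assoc, ← mul_assoc, this]
      simp only [mul_assoc]
      congr 1
      simpa only [mul_assoc] using hs.braid (a + l) h3

lemma mul_dn (hs : BraidSeq n s) {a i k : ℕ} (h1 : a ≤ i) (h2 : i + 1 < a + k) (h3 : i + 1 < n) :
    s i * dn s a k = dn s a k * s (i + 1) := by
  induction k with
  | zero => omega
  | succ k ih =>
    rcases Nat.lt_or_ge (i + 1) (a + k) with h | h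
    · rw [dn_succ, ← mul_assoc, hs.far (i := i) (j := a + k) (by omega), mul_assoc, ih h, mul_assoc]
    · obtain ⟨l, rfl⟩ : ∃ l, k = l + 1 := ⟨k - 1, by omega⟩
      obtain rfl : i = a + l := by omega
      rw [dn_succ, dn_succ, show a + (l + 1) = a + l + 1 by ring]
      have := (hs.commute_dn (i := a + l + 1) (a := a) (k := l) (by omega)).eq
      rw [mul_assoc, mul_assoc, ← this]
      simp only [← mul_assoc]
      congr 1
      exact hs.braid (a + l) h3

/-- Shifting a whole ascending product. -/
lemma up_mul_up (hs : BraidSeq n s) {a k b l : ℕ} (h1 : a ≤ b) (h2 : b + l < a + k)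
    (h3 : b + l < n) : up s a k * up s b l = up s (b + 1) l * up s a k := by
  induction l with
  | zero => simp
  | succ l ih =>
    rw [up_succ, ← mul_assoc, ih (by omega) (by omega), mul_assoc,
      hs.up_mul (by omega) (by omega) (by omega), up_succ, mul_assoc,
      show b + 1 + l = b + l + 1 by ring]

lemma dn_mul_dn (hs : BraidSeq n s) {a k b l : ℕ} (h1 : a ≤ b) (h2 : b + l < a + k)
    (h3 : b + l < n) : dn s b l * dn s a k = dn s a k * dn s (b + 1) l := by
  induction l with
  | zero => simp
  | succ l ih =>
    rw [dn_succ, mul_assoc, ih (by omega) (by omega), ← mul_assoc,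
      hs.mul_dn (by omega) (by omega) (by omega), dn_succ, mul_assoc,
      show b + 1 + l = b + l + 1 by ring]

lemma up_pow_mul (hs : BraidSeq n s) {i k : ℕ} (h : i + k < n) :
    up s 0 n ^ k * s i = s (i + k) * up s 0 n ^ k := by
  induction k with
  | zero => simp
  | succ k ih =>
    rw [pow_succ', mul_assoc, ih (by omega), ← mul_assoc,
      hs.up_mul (by omega) (by omega) (by omega), mul_assoc, add_assoc]

lemma up_sq_mul (hs : BraidSeq (n + 1) s) :
    up s 0 (n + 1) ^ 2 * s n = s 0 * up s 0 (n + 1) ^ 2 := by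
  have h1 : up s 0 (n + 1) * up s 0 n = up s 1 n * up s 0 (n + 1) :=
    hs.up_mul_up (by omega) (by omega) (by omega)
  have h2 : up s 0 (n + 1) ^ 2 = up s 1 n * up s 0 (n + 1) * s n := by
    rw [← h1, sq, mul_assoc, up_succ]; simp
  conv_rhs => rw [h2]
  rw [← mul_assoc, ← mul_assoc, ← up_succ', sq]

/-- The full twist commutes with every generator. -/
lemma fullTwist_mul (hs : BraidSeq n s) {i : ℕ} (h : i < n) :
    up s 0 n ^ (n + 1) * s i = s i * up s 0 n ^ (n + 1) := by
  obtain ⟨m, rfl⟩ : ∃ m, n = m + 1 := ⟨n - 1, by omega⟩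
  have e : m + 1 + 1 = i + (2 + (m - i)) := by omega
  rw [e, pow_add, pow_add, mul_assoc, mul_assoc, hs.up_pow_mul (by omega),
    show i + (m - i) = m by omega, ← mul_assoc (_ ^ 2), hs.up_sq_mul, mul_assoc, ← mul_assoc,
    hs.up_pow_mul (i := 0) (by omega), zero_add, mul_assoc]

/-- Every generator is a right factor of the full twist. -/
lemma exists_mul_eq_fullTwist (hs : BraidSeq n s) {i : ℕ} (h : i < n) :
    ∃ r ∈ Submonoid.closure {x | ∃ i < n, x = s i}, r * s i = up s 0 n ^ (n + 1) := by
  obtain ⟨m, rfl⟩ : ∃ m, n = m + 1 := ⟨n - 1, by omega⟩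
  have hm : ∀ k ≤ m + 1, up s 0 k ∈ Submonoid.closure {x | ∃ i < m + 1, x = s i} := fun k hk =>
    up_mem fun i _ hi => Submonoid.subset_closure ⟨i, by omega, rfl⟩
  refine ⟨up s 0 (m + 1) ^ (i + 1) * up s 0 m * up s 0 (m + 1) ^ (m - i), ?_, ?_⟩
  · exact mul_mem (mul_mem (pow_mem (hm _ le_rfl) _) (hm _ (by omega))) (pow_mem (hm _ le_rfl) _)
  · rw [mul_assoc, hs.up_pow_mul (by omega), show i + (m - i) = 0 + m by omega, ← mul_assoc,
      mul_assoc _ (up s 0 m), ← up_succ, ← pow_succ, ← pow_add]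
    congr 1
    omega

end BraidSeq

end Monoid

/-- The positive braid relations on `n` generators. -/
def posRel (n : ℕ) (w w' : FreeMonoid (Fin n)) : Prop :=
  ∃ i j : Fin n,
    ((i : ℕ) + 1 = j ∧
      w = FreeMonoid.of i * FreeMonoid.of j * FreeMonoid.of i ∧
      w' = FreeMonoid.of j * FreeMonoid.of i * FreeMonoid.of j) ∨
    ((i : ℕ) + 2 ≤ j ∧ w = FreeMonoid.of i * FreeMonoid.of j ∧
      w' = FreeMonoid.of j * FreeMonoid.of i)

/-- The abstract positive braid monoid. -/
abbrev PosBraid (n : ℕ) := PresentedMonoid (posRel n)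

namespace PosBraid

variable {n : ℕ}

/-- The generators of the positive braid monoid. -/
abbrev σ (i : Fin n) : PosBraid n := PresentedMonoid.of (posRel n) i

/-- Indices of commuting distinct generators. -/
def Far (i j : Fin n) : Prop := (i : ℕ) + 2 ≤ j ∨ (j : ℕ) + 2 ≤ i

/-- Indices of braiding generators. -/
def Adj (i j : Fin n) : Prop := (i : ℕ) + 1 = j ∨ (j : ℕ) + 1 = i

lemma Far.symm {i j : Fin n} (h : Far i j) : Far j i := Or.symm h

lemma Adj.symm {i j : Fin n} (h : Adj i j) : Adj j i := Or.symm h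

lemma σ_mul_σ {i j : Fin n} (h : Far i j) : σ i * σ j = σ j * σ i := by
  have key : ∀ i j : Fin n, (i : ℕ) + 2 ≤ j → σ i * σ j = σ j * σ i := fun i j h =>
    (Con.eq _).2 (ConGen.Rel.of _ _ ⟨i, j, Or.inr ⟨h, rfl, rfl⟩⟩)
  rcases h with h | h
  · exact key i j h
  · exact (key j i h).symm

lemma σ_braid {i j : Fin n} (h : Adj i j) : σ i * σ j * σ i = σ j * σ i * σ j := by
  have key : ∀ i j : Fin n, (i : ℕ) + 1 = j → σ i * σ j * σ i = σ j * σ i * σ j := fun i j h =>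
    (Con.eq _).2 (ConGen.Rel.of _ _ ⟨i, j, Or.inl ⟨h, rfl, rfl⟩⟩)
  rcases h with h | h
  · exact key i j h
  · exact (key j i h).symm

lemma mul_far {i j : Fin n} (h : Far i j) (x : PosBraid n) : σ i * (σ j * x) = σ j * (σ i * x) := by
  rw [← mul_assoc, σ_mul_σ h, mul_assoc]

lemma mul_adj {i j : Fin n} (h : Adj i j) (x : PosBraid n) :
    σ i * (σ j * (σ i * x)) = σ j * (σ i * (σ j * x)) := by
  have := congrArg (· * x) (σ_braid h)
  simpa only [mul_assoc] using this

lemma adj' {i j : Fin n} (h : Adj i j) : σ i * (σ j * σ i) = σ j * (σ i * σ j) := by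
  simpa only [mul_assoc] using σ_braid h

/-- The length of a positive braid. -/
def len : PosBraid n →* Multiplicative ℕ :=
  PresentedMonoid.lift (fun _ => Multiplicative.ofAdd 1) (by
    rintro a b ⟨i, j, ⟨-, rfl, rfl⟩ | ⟨-, rfl, rfl⟩⟩ <;> simp)

/-- The length of a positive braid, as a natural number. -/
def length (x : PosBraid n) : ℕ := Multiplicative.toAdd (len x)

lemma length_mul (x y : PosBraid n) : length (x * y) = length x + length y := by
  simp [length]

@[simp] lemma length_σ (i : Fin n) : length (σ i) = 1 := rfl

lemma length_mul_σ (x : PosBraid n) (i : Fin n) : length (x * σ i) = length x + 1 := by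
  rw [length_mul, length_σ]

/-- `u σ_i` and `v σ_j` agree through the least common multiple of `σ_i` and `σ_j`. -/
def Joined (u : PosBraid n) (i : Fin n) (v : PosBraid n) (j : Fin n) : Prop :=
  (i = j ∧ u = v) ∨ (Far i j ∧ ∃ w, u = w * σ j ∧ v = w * σ i) ∨
    (Adj i j ∧ ∃ w, u = w * σ i * σ j ∧ v = w * σ j * σ i)

lemma Joined.symm {u v : PosBraid n} {i j : Fin n} (h : Joined u i v j) : Joined v j u i := by
  rcases h with ⟨rfl, rfl⟩ | ⟨h, w, rfl, rfl⟩ | ⟨h, w, rfl, rfl⟩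
  · exact Or.inl ⟨rfl, rfl⟩
  · exact Or.inr (Or.inl ⟨h.symm, w, rfl, rfl⟩)
  · exact Or.inr (Or.inr ⟨h.symm, w, rfl, rfl⟩)

lemma Joined.mul_left {u v : PosBraid n} {i j : Fin n} (h : Joined u i v j) (x : PosBraid n) :
    Joined (x * u) i (x * v) j := by
  rcases h with ⟨rfl, rfl⟩ | ⟨h, w, rfl, rfl⟩ | ⟨h, w, rfl, rfl⟩
  · exact Or.inl ⟨rfl, rfl⟩
  · exact Or.inr (Or.inl ⟨h, x * w, by simp only [mul_assoc], by simp only [mul_assoc]⟩)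
  · exact Or.inr (Or.inr ⟨h, x * w, by simp only [mul_assoc], by simp only [mul_assoc]⟩)

lemma trichotomy (i j : Fin n) : i = j ∨ Far i j ∨ Adj i j := by
  unfold Far Adj; rw [Fin.ext_iff]; omega

lemma Joined.eq_left {u v : PosBraid n} {i : Fin n} (h : Joined u i v i) : u = v := by
  rcases h with ⟨-, h⟩ | ⟨h, -⟩ | ⟨h, -⟩
  · exact h
  · unfold Far at h; omega
  · unfold Adj at h; omega

lemma Joined.of_far {u v : PosBraid n} {i j : Fin n} (h : Joined u i v j) (hf : Far i j) :
    ∃ w, u = w * σ j ∧ v = w * σ i := by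
  rcases h with ⟨rfl, -⟩ | ⟨-, h⟩ | ⟨h, -⟩
  · unfold Far at hf; omega
  · exact h
  · unfold Far at hf; unfold Adj at h; omega

lemma Joined.of_adj {u v : PosBraid n} {i j : Fin n} (h : Joined u i v j) (hf : Adj i j) :
    ∃ w, u = w * σ i * σ j ∧ v = w * σ j * σ i := by
  rcases h with ⟨rfl, -⟩ | ⟨h, -⟩ | ⟨-, h⟩
  · unfold Adj at hf; omega
  · unfold Adj at hf; unfold Far at h; omega
  · exact h

/-- The joining property for all left factors of length less than `L`. -/
def JoinedBelow (n L : ℕ) : Prop :=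
  ∀ (u v : PosBraid n) (i j : Fin n), length u < L → u * σ i = v * σ j → Joined u i v j

lemma joined_trans_far_adj {L : ℕ} (hL : JoinedBelow n L) {p q : PosBraid n}
    {i j k : Fin n} (hp : length p < L) (hij : Far i j) (hjk : Adj j k)
    (e : p * σ i = q * σ j * σ k) : Joined (p * σ j) i (q * σ k * σ j) k := by
  have lp := congrArg length e
  simp only [length_mul_σ] at lp
  rcases trichotomy i k with rfl | hik | hik
  · unfold Far at hij; unfold Adj at hjk; omega
  · obtain ⟨r, rfl, e2⟩ := (hL p _ i k hp e).of_far hik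
    obtain ⟨r', rfl, rfl⟩ := (hL q r j i (by omega) e2).of_far hij.symm
    refine Or.inr (Or.inl ⟨hik, r' * σ k * σ j, ?_, ?_⟩)
    · simp only [mul_assoc, adj' hjk]
    · simp only [mul_assoc, σ_mul_σ hij, mul_far hik]
  · obtain ⟨r, rfl, e2⟩ := (hL p _ i k hp e).of_adj hik
    simp only [length_mul_σ] at lp hp
    obtain ⟨r', rfl, e3⟩ := (hL q (r * σ k) j i (by omega) e2).of_far hij.symm
    obtain ⟨r'', rfl, rfl⟩ := (hL r r' k j (by omega) e3).of_adj hjk.symm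
    refine Or.inr (Or.inr ⟨hik, r'' * σ i * σ k * σ j, ?_, ?_⟩)
    · simp only [mul_assoc]
      rw [mul_far hij.symm, adj' hjk, mul_adj hik.symm, mul_far hij]
    · simp only [mul_assoc]
      rw [← mul_adj hik, mul_far hij.symm, σ_mul_σ hij, mul_adj hjk]

lemma joined_trans {L : ℕ} (hL : JoinedBelow n L) {u v w : PosBraid n} {i j k : Fin n}
    (hv : length v = L) (h1 : Joined u i v j) (h2 : Joined v j w k) : Joined u i w k := by
  rcases h1 with ⟨rfl, rfl⟩ | ⟨hij, p, rfl, rfl⟩ | ⟨hij, p, rfl, rfl⟩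
  · exact h2
  · rcases h2 with ⟨rfl, rfl⟩ | ⟨hjk, q, e, rfl⟩ | ⟨hjk, q, e, rfl⟩
    · exact Or.inr (Or.inl ⟨hij, p, rfl, rfl⟩)
    · rw [length_mul_σ] at hv
      have e' := hL p q i k (by omega) e
      rcases trichotomy i k with rfl | hik | hik
      · rw [e'.eq_left]; exact Or.inl ⟨rfl, rfl⟩
      · obtain ⟨r, rfl, rfl⟩ := e'.of_far hik
        refine Or.inr (Or.inl ⟨hik, r * σ j, ?_, ?_⟩)
        · simp only [mul_assoc, σ_mul_σ hjk]
        · simp only [mul_assoc, σ_mul_σ hij]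
      · obtain ⟨r, rfl, rfl⟩ := e'.of_adj hik
        refine Or.inr (Or.inr ⟨hik, r * σ j, ?_, ?_⟩)
        · simp only [mul_assoc]; rw [← σ_mul_σ hjk, mul_far hij]
        · simp only [mul_assoc]; rw [σ_mul_σ hij, ← mul_far hjk]
    · rw [length_mul_σ] at hv
      exact joined_trans_far_adj hL (by omega) hij hjk e
  · rcases h2 with ⟨rfl, rfl⟩ | ⟨hjk, q, e, rfl⟩ | ⟨hjk, q, e, rfl⟩
    · exact Or.inr (Or.inr ⟨hij, p, rfl, rfl⟩)
    · have lq := congrArg length e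
      simp only [length_mul_σ] at lq hv
      exact (joined_trans_far_adj hL (by omega) hjk.symm hij.symm e.symm).symm
    · have lq := congrArg length e
      simp only [length_mul_σ] at lq hv
      have e' := hL (p * σ j) (q * σ j) i k (by rw [length_mul_σ]; omega) e
      rcases trichotomy i k with rfl | hik | hik
      · rw [(hL p q j j (by omega) e'.eq_left).eq_left]; exact Or.inl ⟨rfl, rfl⟩
      · obtain ⟨r, e1, e2⟩ := e'.of_far hik
        obtain ⟨r1, rfl, rfl⟩ := (hL p r j k (by omega) e1).of_adj hjk
        obtain ⟨r2, rfl, e3⟩ := (hL q _ j i (by omega) e2).of_adj hij.symm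
        simp only [length_mul_σ] at lq hv
        have e4 := (hL (r1 * σ k) (r2 * σ i) j j (by rw [length_mul_σ]; omega) e3).eq_left
        obtain ⟨t, rfl, rfl⟩ := (hL r1 r2 k i (by omega) e4).of_far hik.symm
        refine Or.inr (Or.inl ⟨hik, t * σ j * σ i * σ k * σ j, ?_, ?_⟩)
        · simp only [mul_assoc]
          rw [← mul_far hik, mul_adj hij, adj' hjk]
        · simp only [mul_assoc]
          rw [mul_far hik, mul_adj hjk.symm, ← adj' hij, mul_far hik.symm]
      · unfold Adj at *; omega

lemma word_length_eq {w w' : FreeMonoid (Fin n)} (h : conGen (posRel n) w w') :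
    w.length = w'.length := by
  induction h with
  | of x y h => rcases h with ⟨i, j, ⟨-, rfl, rfl⟩ | ⟨-, rfl, rfl⟩⟩ <;> simp
  | refl x => rfl
  | symm _ ih => exact ih.symm
  | trans _ _ ih1 ih2 => exact ih1.trans ih2
  | mul _ _ ih1 ih2 => simp [ih1, ih2]

lemma length_mk (w : FreeMonoid (Fin n)) :
    length (PresentedMonoid.mk (posRel n) w) = w.length := by
  induction w using FreeMonoid.inductionOn' with
  | one => simp [length]
  | of_mul x xs ih => rw [map_mul, length_mul, ih, FreeMonoid.length_mul]; rfl

lemma word_eq_mul_of {w : FreeMonoid (Fin n)} (h : w.length ≠ 0) :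
    ∃ (U : FreeMonoid (Fin n)) (i : Fin n), w = U * FreeMonoid.of i := by
  rcases List.eq_nil_or_concat (FreeMonoid.toList w) with h' | ⟨U, i, h'⟩
  · exact absurd (congrArg List.length h') h
  · exact ⟨FreeMonoid.ofList U, i, h'.trans List.concat_eq_append⟩

lemma word_mul_of_inj {U V : FreeMonoid (Fin n)} {i j : Fin n}
    (h : U * FreeMonoid.of i = V * FreeMonoid.of j) : U = V ∧ i = j := by
  have h2 : FreeMonoid.toList U ++ [i] = FreeMonoid.toList V ++ [j] := congrArg FreeMonoid.toList h
  have h3 := List.append_inj' h2 rfl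
  exact ⟨FreeMonoid.toList.injective h3.1, by simpa using h3.2⟩

lemma joined_of_rel {L : ℕ} (hL : JoinedBelow n L) {w w' : FreeMonoid (Fin n)}
    (h : conGen (posRel n) w w') : ∀ U i V j, w = U * FreeMonoid.of i →
      w' = V * FreeMonoid.of j → w.length ≤ L + 1 →
      Joined (PresentedMonoid.mk (posRel n) U) i (PresentedMonoid.mk (posRel n) V) j := by
  induction h with
  | of x y h =>
    rintro U i V j e1 e2 -
    rcases h with ⟨a, b, ⟨h, rfl, rfl⟩ | ⟨h, rfl, rfl⟩⟩ <;>
    obtain ⟨rfl, rfl⟩ := word_mul_of_inj e1 <;>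
    obtain ⟨rfl, rfl⟩ := word_mul_of_inj e2
    · exact Or.inr (Or.inr ⟨Or.inl h, 1, by rw [one_mul]; rfl, by rw [one_mul]; rfl⟩)
    · exact Or.inr (Or.inl ⟨(show Far b a from Or.inr h), 1, by rw [one_mul]; rfl,
        by rw [one_mul]; rfl⟩)
  | refl x =>
    rintro U i V j rfl e2 -
    obtain ⟨rfl, rfl⟩ := word_mul_of_inj e2
    exact Or.inl ⟨rfl, rfl⟩
  | symm h ih =>
    intro U i V j e1 e2 hl
    exact (ih V j U i e2 e1 (by rwa [word_length_eq h])).symm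
  | @trans x y z h1 h2 ih1 ih2 =>
    intro U i V j e1 e2 hl
    have l1 := word_length_eq h1
    have l2 := word_length_eq h2
    obtain ⟨W, k, rfl⟩ := word_eq_mul_of (w := y) (by
      rw [← l1, e1, FreeMonoid.length_mul, FreeMonoid.length_of]; omega)
    have j1 := ih1 U i W k e1 rfl hl
    have j2 := ih2 W k V j rfl e2 (by omega)
    rw [l1, FreeMonoid.length_mul, FreeMonoid.length_of] at hl
    refine joined_trans (L := length (PresentedMonoid.mk (posRel n) W)) ?_ rfl j1 j2
    intro u v i j hu
    exact hL u v i j (by rw [length_mk] at hu; omega)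
  | @mul w x y z h1 h2 ih1 ih2 =>
    intro U i V j e1 e2 hl
    have l2 := word_length_eq h2
    rw [FreeMonoid.length_mul] at hl
    by_cases hy : y.length = 0
    · obtain rfl := FreeMonoid.length_eq_zero.1 hy
      obtain rfl := FreeMonoid.length_eq_zero.1 (l2.symm.trans hy)
      rw [mul_one] at e1 e2
      exact ih1 U i V j e1 e2 (by omega)
    · obtain ⟨Y, a, rfl⟩ := word_eq_mul_of hy
      obtain ⟨Z, b, rfl⟩ := word_eq_mul_of (l2 ▸ hy)
      rw [← mul_assoc] at e1 e2
      obtain ⟨rfl, rfl⟩ := word_mul_of_inj e1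
      obtain ⟨rfl, rfl⟩ := word_mul_of_inj e2
      rw [map_mul, map_mul, show PresentedMonoid.mk (posRel n) w = PresentedMonoid.mk (posRel n) x
        from (Con.eq _).2 h1]
      exact (ih2 Y a Z b rfl rfl (by omega)).mul_left _

lemma joinedBelow (L : ℕ) : JoinedBelow n L := by
  induction L with
  | zero => intro u v i j h; omega
  | succ L ih =>
    intro u v i j hu e
    obtain ⟨U, rfl⟩ := PresentedMonoid.surjective_mk u
    obtain ⟨V, rfl⟩ := PresentedMonoid.surjective_mk v
    refine joined_of_rel ih ((Con.eq _).1 e) U i V j rfl rfl ?_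
    rw [length_mk] at hu
    rw [FreeMonoid.length_mul, FreeMonoid.length_of]
    omega

/-- Garside's lemma: a common right multiple of two generators factors through their least common
multiple. -/
lemma joined_of_eq {u v : PosBraid n} {i j : Fin n} (h : u * σ i = v * σ j) : Joined u i v j :=
  joinedBelow _ u v i j (Nat.lt_succ_self _) h

lemma mul_right_cancel_word {u v : PosBraid n} (w : FreeMonoid (Fin n))
    (h : u * PresentedMonoid.mk (posRel n) w = v * PresentedMonoid.mk (posRel n) w) : u = v := by
  induction w using FreeMonoid.inductionOn' generalizing u v with
  | one => simpa using h
  | of_mul x xs ih =>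
    rw [map_mul, ← mul_assoc, ← mul_assoc] at h
    exact (joined_of_eq (i := x) (j := x) (ih h)).eq_left

lemma right_cancel {u v x : PosBraid n} (h : u * x = v * x) : u = v := by
  obtain ⟨w, rfl⟩ := PresentedMonoid.surjective_mk x
  exact mul_right_cancel_word w h

/-- The generators of the positive braid monoid indexed by all natural numbers. -/
def τ (n i : ℕ) : PosBraid n := if h : i < n then σ ⟨i, h⟩ else 1

lemma τ_val (i : Fin n) : τ n i = σ i := dif_pos i.2

lemma braidSeq_τ : BraidSeq n (τ n) where
  braid i hi := by
    have h : i < n := by omega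
    simpa only [τ, dif_pos h, dif_pos hi] using
      σ_braid (i := ⟨i, h⟩) (j := ⟨i + 1, hi⟩) (Or.inl rfl)
  comm i j hij := by
    by_cases hj : j < n
    · have h : i < n := by omega
      simpa only [τ, dif_pos h, dif_pos hj] using
        σ_mul_σ (i := ⟨i, h⟩) (j := ⟨j, hj⟩) (Or.inl hij)
    · simp only [τ, dif_neg hj, mul_one, one_mul]

/-- The full twist of the positive braid monoid. -/
def twist (n : ℕ) : PosBraid n := up (τ n) 0 n ^ (n + 1)

lemma twist_comm (x : PosBraid n) : twist n * x = x * twist n := by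
  obtain ⟨w, rfl⟩ := PresentedMonoid.surjective_mk x
  induction w using FreeMonoid.inductionOn' with
  | one => simp
  | of_mul x xs ih =>
    have h : twist n * σ x = σ x * twist n := by
      rw [← τ_val]; exact braidSeq_τ.fullTwist_mul x.2
    rw [map_mul, ← mul_assoc]
    change twist n * σ x * _ = σ x * _ * _
    rw [h, mul_assoc, ih, mul_assoc]

lemma pow_twist_comm {d : PosBraid n} (hd : d ∈ Submonoid.powers (twist n)) (x : PosBraid n) :
    d * x = x * d := by
  obtain ⟨k, rfl⟩ := hd
  exact (Commute.pow_left (twist_comm x) k).eq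

/-- The powers of the full twist form an Ore set. -/
instance : OreLocalization.OreSet (Submonoid.powers (twist n)) where
  ore_right_cancel r₁ r₂ d h := ⟨d, by rwa [pow_twist_comm d.2, pow_twist_comm d.2]⟩
  oreNum r _ := r
  oreDenom _ d := d
  ore_eq r d := pow_twist_comm d.2 r

/-- The localization of the positive braid monoid at the full twist. -/
abbrev Loc (n : ℕ) := OreLocalization (Submonoid.powers (twist n)) (PosBraid n)

/-- The canonical map to the localization. -/
abbrev toLoc : PosBraid n →* Loc n := OreLocalization.numeratorHom

lemma toLoc_injective : Function.Injective (toLoc (n := n)) := by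
  intro x y h
  rw [OreLocalization.numeratorHom_apply, OreLocalization.numeratorHom_apply,
    OreLocalization.oreDiv_eq_iff] at h
  obtain ⟨u, v, h1, h2⟩ := h
  simp only [Submonoid.coe_one, mul_one] at h2
  rw [← h2, Submonoid.smul_def, smul_eq_mul, smul_eq_mul, pow_twist_comm u.2,
    pow_twist_comm u.2] at h1
  exact (right_cancel h1).symm

lemma isUnit_toLoc_σ (i : Fin n) : IsUnit (toLoc (σ i)) := by
  obtain ⟨r, -, hr⟩ := braidSeq_τ.exists_mul_eq_fullTwist i.2
  rw [τ_val] at hr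
  change r * σ i = twist n at hr
  have hr' : σ i * r = twist n := by
    refine right_cancel (x := σ i) ?_
    rw [mul_assoc, hr, twist_comm]
  obtain ⟨d, hd⟩ := OreLocalization.numerator_isUnit
    (⟨twist n, Submonoid.mem_powers _⟩ : Submonoid.powers (twist n))
  change (d : Loc n) = toLoc (twist n) at hd
  have e1 : toLoc (σ i) * toLoc r = d := by rw [← map_mul, hr', hd]
  have e2 : toLoc r * toLoc (σ i) = d := by rw [← map_mul, hr, hd]
  refine isUnit_iff_exists_and_exists.2 ⟨⟨toLoc r * ↑d⁻¹, ?_⟩, ⟨↑d⁻¹ * toLoc r, ?_⟩⟩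
  · rw [← mul_assoc, e1, Units.mul_inv]
  · rw [mul_assoc, e2, Units.inv_mul]

end PosBraid

namespace BraidOrder

open PosBraid

/-- The canonical map from the braid group to the units of the localization of the positive
monoid. -/
noncomputable def toUnitsLoc (n : ℕ) : Braid n →* (Loc n)ˣ :=
  PresentedGroup.toGroup (f := fun i => (isUnit_toLoc_σ i).unit) (by
    rintro r ⟨i, j, ⟨h, rfl⟩ | ⟨h, rfl⟩⟩
    · rw [map_mul, map_inv, mul_inv_eq_one]
      ext
      simp only [map_mul, FreeGroup.lift_apply_of, Units.val_mul, IsUnit.unit_spec]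
      rw [← map_mul, ← map_mul, ← map_mul, ← map_mul, σ_braid (Or.inl h)]
    · rw [map_mul, map_inv, mul_inv_eq_one]
      ext
      simp only [map_mul, FreeGroup.lift_apply_of, Units.val_mul, IsUnit.unit_spec]
      rw [← map_mul, ← map_mul, σ_mul_σ (Or.inl h)])

lemma gen_val {n : ℕ} (i : Fin n) : gen n i = PresentedGroup.of i := dif_pos i.2

lemma gen_of_le {n i : ℕ} (h : n ≤ i) : gen n i = 1 := dif_neg (by omega)

lemma braidSeq_gen (n : ℕ) : BraidSeq n (gen n) where
  braid i hi := by
    have h : i < n := by omega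
    rw [show gen n i = _ from dif_pos h, show gen n (i + 1) = _ from dif_pos hi]
    refine mul_inv_eq_one.1 ?_
    exact (PresentedGroup.one_of_mem (rels := braidRel n)
      ⟨⟨i, h⟩, ⟨i + 1, hi⟩, Or.inl ⟨rfl, rfl⟩⟩)
  comm i j hij := by
    by_cases hj : j < n
    · have h : i < n := by omega
      rw [show gen n i = _ from dif_pos h, show gen n j = _ from dif_pos hj]
      refine mul_inv_eq_one.1 ?_
      exact (PresentedGroup.one_of_mem (rels := braidRel n)
        ⟨⟨i, h⟩, ⟨j, hj⟩, Or.inr ⟨hij, rfl⟩⟩)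
    · rw [gen_of_le (by omega : n ≤ j), mul_one, one_mul]

/-- The canonical map from the positive braid monoid to the braid group. -/
noncomputable def ofPos (n : ℕ) : PosBraid n →* Braid n :=
  PresentedMonoid.lift (rels := posRel n) (fun i : Fin n => gen n i) (by
    rintro a b ⟨i, j, ⟨h, rfl, rfl⟩ | ⟨h, rfl, rfl⟩⟩
    · simp only [map_mul, FreeMonoid.lift_eval_of, ← h]
      exact (braidSeq_gen n).braid i (by omega)
    · simp only [map_mul, FreeMonoid.lift_eval_of]
      exact (braidSeq_gen n).comm i j h)

lemma ofPos_injective (n : ℕ) : Function.Injective (ofPos n) := by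
  have h : (Units.coeHom (Loc n)).comp ((toUnitsLoc n).comp (ofPos n)) = toLoc := by
    refine PresentedMonoid.ext _ fun i => ?_
    change ((toUnitsLoc n (gen n i) : (Loc n)ˣ) : Loc n) = toLoc (σ i)
    rw [gen_val, toUnitsLoc, PresentedGroup.toGroup.of, IsUnit.unit_spec]
  intro x y hxy
  refine toLoc_injective ?_
  rw [← h]
  simp [hxy]

lemma exists_ofPos {n : ℕ} {a : Braid n} (ha : a ∈ Mb n) : ∃ x, ofPos n x = a := by
  have : Mb n ≤ MonoidHom.mrange (ofPos n) := by
    refine Submonoid.closure_le.2 ?_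
    rintro _ ⟨i, hi, rfl⟩
    exact ⟨σ ⟨i, hi⟩, rfl⟩
  exact this ha

lemma gen_mem_Mb {n : ℕ} (i : ℕ) : gen n i ∈ Mb n := by
  by_cases hi : i < n
  · exact Submonoid.subset_closure ⟨i, hi, rfl⟩
  · rw [gen_of_le (by omega)]; exact one_mem _

lemma ofPos_mem {n : ℕ} (x : PosBraid n) : ofPos n x ∈ Mb n := by
  obtain ⟨w, rfl⟩ := PresentedMonoid.surjective_mk x
  induction w using FreeMonoid.inductionOn' with
  | one => simp
  | of_mul x xs ih =>
    rw [map_mul, map_mul]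
    exact mul_mem (gen_mem_Mb x) ih

/-- If two generators right-divide a positive braid, then so does their least common multiple. -/
lemma lcm_dvd {n : ℕ} {u v : Braid n} (hu : u ∈ Mb n) (hv : v ∈ Mb n) {i j : ℕ}
    (hi : i < n) (hj : j < n) (h : u * gen n i = v * gen n j) :
    (i = j ∧ u = v) ∨
    ((i + 2 ≤ j ∨ j + 2 ≤ i) ∧ ∃ w ∈ Mb n, u = w * gen n j ∧ v = w * gen n i) ∨
    ((i + 1 = j ∨ j + 1 = i) ∧ ∃ w ∈ Mb n, u = w * gen n i * gen n j ∧
      v = w * gen n j * gen n i) := by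
  obtain ⟨x, rfl⟩ := exists_ofPos hu
  obtain ⟨y, rfl⟩ := exists_ofPos hv
  have e : x * σ ⟨i, hi⟩ = y * σ ⟨j, hj⟩ := by
    apply ofPos_injective n
    rw [map_mul, map_mul]
    exact h
  rcases joined_of_eq e with ⟨e1, rfl⟩ | ⟨h', w, rfl, rfl⟩ | ⟨h', w, rfl, rfl⟩
  · exact Or.inl ⟨congrArg Fin.val e1, rfl⟩
  · exact Or.inr (Or.inl ⟨h', ofPos n w, ofPos_mem _, map_mul _ _ _, map_mul _ _ _⟩)
  · exact Or.inr (Or.inr ⟨h', ofPos n w, ofPos_mem _, by rw [map_mul, map_mul]; rfl,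
      by rw [map_mul, map_mul]; rfl⟩)

end BraidOrder

namespace ArtinAction

open FreeGroup

/-- The image of the generators under the `i`-th Artin automorphism. -/
def artinFun (i k : ℕ) : FreeGroup ℕ :=
  if k = i then of i * of (i + 1) * (of i)⁻¹ else if k = i + 1 then of i else of k

/-- The image of the generators under the inverse of the `i`-th Artin automorphism. -/
def artinInvFun (i k : ℕ) : FreeGroup ℕ :=
  if k = i then of (i + 1) else if k = i + 1 then (of (i + 1))⁻¹ * of i * of (i + 1) else of k

/-- The `i`-th Artin automorphism of the free group. -/
def artin (i : ℕ) : MulAut (FreeGroup ℕ) :=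
  MonoidHom.toMulEquiv (lift (artinFun i)) (lift (artinInvFun i))
    (by
      ext k
      simp only [MonoidHom.comp_apply, lift_apply_of, MonoidHom.id_apply]
      by_cases h1 : k = i
      · subst h1; simp [artinFun, artinInvFun, mul_assoc]
      · by_cases h2 : k = i + 1
        · subst h2; simp [artinFun, artinInvFun]
        · simp [artinFun, artinInvFun, h1, h2])
    (by
      ext k
      simp only [MonoidHom.comp_apply, lift_apply_of, MonoidHom.id_apply]
      by_cases h1 : k = i
      · subst h1; simp [artinFun, artinInvFun]
      · by_cases h2 : k = i + 1
        · subst h2; simp [artinFun, artinInvFun, mul_assoc]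
        · simp [artinFun, artinInvFun, h1, h2])

lemma artin_of (i k : ℕ) : artin i (of k) = artinFun i k := lift_apply_of ..

lemma artin_inv_of (i k : ℕ) : (artin i)⁻¹ (of k) = artinInvFun i k := lift_apply_of ..

lemma mulAut_ext {f g : MulAut (FreeGroup ℕ)} (h : ∀ k, f (of k) = g (of k)) : f = g := by
  have : f.toMonoidHom = g.toMonoidHom := by ext k; exact h k
  ext x
  exact DFunLike.congr_fun this x

lemma artin_braid (i : ℕ) :
    artin i * artin (i + 1) * artin i = artin (i + 1) * artin i * artin (i + 1) := by
  apply mulAut_ext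
  intro k
  have e1 : i ≠ i + 1 + 1 := by omega
  have e2 : i + 1 + 1 ≠ i := by omega
  simp only [MulAut.mul_apply, artin_of]
  by_cases h1 : k = i
  · subst h1; simp [artinFun, artin_of, mul_assoc, e1, e2]
  · by_cases h2 : k = i + 1
    · subst h2; simp [artinFun, artin_of, mul_assoc, e1, e2]
    · by_cases h3 : k = i + 1 + 1
      · subst h3; simp [artinFun, artin_of, e1, e2]
      · simp [artinFun, artin_of, h1, h2, h3]

lemma artin_comm {i j : ℕ} (h : i + 2 ≤ j) : artin i * artin j = artin j * artin i := by
  apply mulAut_ext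
  intro k
  have e1 : j ≠ i := by omega
  have e2 : j ≠ i + 1 := by omega
  have e3 : j + 1 ≠ i := by omega
  have e4 : i ≠ j := by omega
  have e5 : i + 1 ≠ j := by omega
  have e6 : i ≠ j + 1 := by omega
  simp only [MulAut.mul_apply, artin_of]
  by_cases h1 : k = i
  · subst h1; simp [artinFun, artin_of, *]
  · by_cases h2 : k = i + 1
    · subst h2; simp [artinFun, artin_of, *]
    · by_cases h3 : k = j
      · subst h3; simp [artinFun, artin_of, *]
      · by_cases h4 : k = j + 1
        · subst h4; simp [artinFun, artin_of, *]
        · simp [artinFun, artin_of, *]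

/-- The Artin action of the braid group on the free group. -/
def action (n : ℕ) : BraidOrder.Braid n →* MulAut (FreeGroup ℕ) :=
  PresentedGroup.toGroup (rels := BraidOrder.braidRel n) (f := fun i : Fin n => artin i) (by
    rintro r ⟨i, j, ⟨h, rfl⟩ | ⟨h, rfl⟩⟩
    · rw [_root_.map_mul, _root_.map_inv, mul_inv_eq_one]
      simp only [_root_.map_mul, FreeGroup.lift_apply_of, ← h]
      exact artin_braid i
    · rw [_root_.map_mul, _root_.map_inv, mul_inv_eq_one]
      simp only [_root_.map_mul, FreeGroup.lift_apply_of]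
      exact artin_comm h)

lemma action_gen {n i : ℕ} (h : i < n) : action n (BraidOrder.gen n i) = artin i := by
  rw [show BraidOrder.gen n i = _ from dif_pos h, action, PresentedGroup.toGroup.of]

lemma mk_cons (l : ℕ × Bool) (L : List (ℕ × Bool)) : mk (l :: L) = mk [l] * mk L := by
  rw [mul_mk]; rfl

lemma mk_true (k : ℕ) : mk [(k, true)] = of k := rfl

lemma mk_false (k : ℕ) : mk [(k, false)] = (of k)⁻¹ := rfl

/-- The elements whose reduced word starts with the letter `x₀`. -/
def StartsZero (w : FreeGroup ℕ) : Prop := w.toWord.head? = some (0, true)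

/-- How the first letter of a reduced word controls its image under the `0`-th Artin
automorphism. -/
def FirstLetter : List (ℕ × Bool) → List (ℕ × Bool) → Prop
  | [], W => W = [(0, false)]
  | (0, e) :: _, W => ∃ T, W = (1, e) :: T
  | (1, false) :: _, W => ∃ T, W = (0, false) :: T ∧ ∀ j e, T.head? ≠ some (j + 2, e)
  | (1, true) :: _, W => W.head? ≠ some (0, false) ∧ ∀ e, W.head? ≠ some (1, e)
  | (j + 2, e) :: _, W => ∃ T, W = (0, false) :: (j + 2, e) :: T

lemma isReduced_cons {l : ℕ × Bool} {L : List (ℕ × Bool)} :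
    FreeGroup.IsReduced (l :: L) ↔ (∀ b, L.head? ≠ some (l.1, b) ∨ b = l.2) ∧ FreeGroup.IsReduced L := by
  unfold FreeGroup.IsReduced
  rw [List.isChain_cons]
  refine and_congr_left fun _ => ?_
  constructor
  · intro h b
    by_cases hb : L.head? = some (l.1, b)
    · exact Or.inr (h _ hb rfl).symm
    · exact Or.inl hb
  · rintro h ⟨k, b⟩ hy rfl
    exact ((h b).resolve_left (fun h' => h' hy)).symm

lemma firstLetter (L : List (ℕ × Bool)) (hL : FreeGroup.IsReduced L) :
    ∃ W, FreeGroup.IsReduced W ∧ artin 0 (mk L) = of 0 * mk W ∧ FirstLetter L W := by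
  induction L with
  | nil => exact ⟨[(0, false)], by simp, by simp [mk_false, ← one_eq_mk], rfl⟩
  | cons l L ih =>
    obtain ⟨hl, hL'⟩ := isReduced_cons.1 hL
    obtain ⟨W, hW, e, hF⟩ := ih hL'
    have e' : artin 0 (mk (l :: L)) = artin 0 (mk [l]) * (of 0 * mk W) := by
      rw [mk_cons, _root_.map_mul, e]
    have red : ∀ l W, FreeGroup.IsReduced W → (∀ b, W.head? = some (l.1, b) → b = l.2) →
        FreeGroup.IsReduced (l :: W) := fun l W h1 h2 =>
      isReduced_cons.2 ⟨fun b => by by_cases h : W.head? = some (l.1, b) <;> simp_all, h1⟩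
    rcases l with ⟨_ | _ | j, b⟩
    · refine ⟨(1, b) :: W, ?_, ?_, W, rfl⟩
      · refine red _ _ hW fun c hc => ?_
        rcases L with _ | ⟨⟨_ | _ | k, d⟩, L⟩
        · simp_all [FirstLetter]
        · obtain ⟨T, rfl⟩ := hF; specialize hl d; simp_all
        · cases d
          · obtain ⟨T, rfl, -⟩ := hF; simp_all
          · exact absurd hc (hF.2 c)
        · obtain ⟨T, rfl⟩ := hF; simp_all
      · rw [e', mk_cons _ W]
        cases b <;> simp [mk_true, mk_false, artin_of, artinFun, mul_assoc]
    · cases b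
      · refine ⟨(0, false) :: W, ?_, ?_, W, rfl, fun j d hj => ?_⟩
        · refine red _ _ hW fun c hc => ?_
          rcases L with _ | ⟨⟨_ | _ | k, d⟩, L⟩
          · simp_all [FirstLetter]
          · obtain ⟨T, rfl⟩ := hF; simp_all
          · obtain rfl : d = false := by specialize hl d; simp_all
            obtain ⟨T, rfl, -⟩ := hF; simp_all
          · obtain ⟨T, rfl⟩ := hF; simp_all
        · rw [e', mk_cons _ W]
          simp [mk_false, artin_of, artinFun]
        · rcases L with _ | ⟨⟨_ | _ | k, c⟩, L⟩
          · simp_all [FirstLetter]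
          · obtain ⟨T, rfl⟩ := hF; simp_all
          · obtain rfl : c = false := by specialize hl c; simp_all
            obtain ⟨T, rfl, -⟩ := hF; simp_all
          · obtain ⟨T, rfl⟩ := hF; simp_all
      · by_cases h0 : W.head? = some (0, false)
        · obtain ⟨T, rfl⟩ : ∃ T, W = (0, false) :: T := by
            rcases W with _ | ⟨w, T⟩ <;> simp_all
          have hT : T.head? = none ∨ ∃ k d, T.head? = some (k + 2, d) := by
            rcases L with _ | ⟨⟨_ | _ | k, d⟩, L⟩
            · simp_all [FirstLetter]
            · simp_all [FirstLetter]
            · cases d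
              · have := hl false; simp at this
              · exact absurd h0 hF.1
            · obtain ⟨T', h⟩ := hF; simp_all
          refine ⟨T, (isReduced_cons.1 hW).2, ?_, ?_, ?_⟩
          · rw [e', mk_cons _ T]
            simp [mk_true, mk_false, artin_of, artinFun]
          · rcases hT with hT | ⟨k, d, hT⟩ <;> simp [hT]
          · rcases hT with hT | ⟨k, d, hT⟩ <;> simp [hT]
        · refine ⟨(0, true) :: W, red _ _ hW fun c hc => ?_, ?_, by simp, by simp⟩
          · cases c
            · exact absurd hc h0
            · rfl
          · rw [e', mk_cons _ W]
            simp [mk_true, artin_of, artinFun]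
    · by_cases h0 : W.head? = some (0, false)
      · obtain ⟨T, rfl⟩ : ∃ T, W = (0, false) :: T := by
          rcases W with _ | ⟨w, T⟩ <;> simp_all
        refine ⟨(0, false) :: (j + 2, b) :: T, ?_, ?_, T, rfl⟩
        · refine red _ _ (red _ _ (isReduced_cons.1 hW).2 fun c hc => ?_) (by simp)
          rcases L with _ | ⟨⟨_ | _ | k, d⟩, L⟩
          · simp_all [FirstLetter]
          · simp_all [FirstLetter]
          · cases d
            · obtain ⟨T', h, h'⟩ := hF
              simp only [List.cons.injEq, true_and] at h
              subst h
              exact absurd hc (h' _ _)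
            · exact absurd h0 hF.1
          · obtain ⟨T', h⟩ := hF; specialize hl d; simp_all
        · rw [e', mk_cons _ T, mk_cons _ (_ :: T), mk_cons _ T]
          cases b <;> simp [mk_true, mk_false, artin_of, artinFun]
      · refine ⟨(0, false) :: (j + 2, b) :: (0, true) :: W, ?_, ?_, _, rfl⟩
        · refine red _ _ (red _ _ (red _ _ hW fun c hc => ?_) (by simp)) (by simp)
          cases c
          · exact absurd hc h0
          · rfl
        · rw [e', mk_cons _ (_ :: _ :: W), mk_cons _ (_ :: W), mk_cons _ W]
          cases b <;> simp [mk_true, mk_false, artin_of, artinFun]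

lemma toWord_mk_of_isReduced {L : List (ℕ × Bool)} (h : FreeGroup.IsReduced L) :
    (mk L).toWord = L := by
  rw [toWord_mk, h.reduce_eq]

lemma startsZero_artin_zero {w : FreeGroup ℕ} (h : StartsZero w) : StartsZero (artin 0 w) := by
  obtain ⟨W, hW, e, hF⟩ := firstLetter w.toWord isReduced_toWord
  rw [mk_toWord] at e
  unfold StartsZero at h ⊢
  obtain ⟨L, hL⟩ : ∃ L, w.toWord = (0, true) :: L := by
    rcases hw : w.toWord with _ | ⟨l, L⟩ <;> simp_all
  rw [hL] at hF
  obtain ⟨T, rfl⟩ := hF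
  rw [e, ← mk_true, ← mk_cons, toWord_mk_of_isReduced]
  · rfl
  · exact isReduced_cons.2 ⟨by simp, hW⟩

/-- Elements represented by a word that avoids the letter `x₀`. -/
def avoidZero : Submonoid (FreeGroup ℕ) where
  carrier := {w | ∀ l ∈ w.toWord, l.1 ≠ 0}
  one_mem' := by simp
  mul_mem' {x y} hx hy := by
    intro l hl
    rcases List.mem_append.1 ((toWord_mul_sublist x y).subset hl) with h | h
    · exact hx l h
    · exact hy l h

lemma inv_mem_avoidZero {x : FreeGroup ℕ} (h : x ∈ avoidZero) : x⁻¹ ∈ avoidZero := by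
  intro l hl
  rw [toWord_inv] at hl
  simp only [invRev, List.mem_reverse, List.mem_map] at hl
  obtain ⟨a, ha, rfl⟩ := hl
  exact h a ha

lemma of_mem_avoidZero {k : ℕ} (h : k ≠ 0) : of k ∈ avoidZero := by
  intro l hl
  rw [toWord_of] at hl
  simp_all

lemma image_mem_avoidZero {f : MulAut (FreeGroup ℕ)} (h : ∀ k ≠ 0, f (of k) ∈ avoidZero)
    {L : List (ℕ × Bool)} (hL : ∀ l ∈ L, l.1 ≠ 0) : f (mk L) ∈ avoidZero := by
  induction L with
  | nil => rw [← one_eq_mk, _root_.map_one]; exact one_mem _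
  | cons l L ih =>
    rw [mk_cons, _root_.map_mul]
    refine mul_mem ?_ (ih fun l' hl' => hL l' (List.mem_cons_of_mem _ hl'))
    obtain ⟨k, b⟩ := l
    have hk := h k (hL _ List.mem_cons_self)
    cases b
    · rw [mk_false, _root_.map_inv]; exact inv_mem_avoidZero hk
    · exact hk

/-- An automorphism fixing `x₀` and preserving the subgroup generated by the other letters does not
change whether, and with which sign, a reduced word starts with `x₀`. -/
lemma head_image {f : MulAut (FreeGroup ℕ)} (h0 : f (of 0) = of 0)
    (h : ∀ k ≠ 0, f (of k) ∈ avoidZero) (N : ℕ) : ∀ L : List (ℕ × Bool), L.length ≤ N →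
      FreeGroup.IsReduced L → ∀ b, (f (mk L)).toWord.head? = some (0, b) ↔ L.head? = some (0, b) := by
  induction N with
  | zero =>
    intro L hN _ b
    obtain rfl := List.length_eq_zero_iff.1 (Nat.le_zero.1 hN)
    rw [← one_eq_mk, _root_.map_one]
    simp
  | succ N ih =>
    rintro (_ | ⟨⟨k, c⟩, L⟩) hN hL b
    · rw [← one_eq_mk, _root_.map_one]
      simp
    obtain ⟨hl, hL'⟩ := isReduced_cons.1 hL
    simp only [List.length_cons] at hN
    by_cases hk : k = 0
    · subst hk
      have e : f (mk ((0, c) :: L)) = mk ((0, c) :: (f (mk L)).toWord) := by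
        rw [mk_cons, _root_.map_mul, mk_cons _ (toWord _), mk_toWord]
        congr 1
        cases c
        · rw [mk_false, _root_.map_inv, h0]
        · exact h0
      rw [e, toWord_mk_of_isReduced]
      · simp
      · refine isReduced_cons.2 ⟨fun d => ?_, isReduced_toWord⟩
        rw [Ne, ih L (by omega) hL' d]
        exact hl d
    · set p : ℕ × Bool → Bool := fun l => decide (l.1 ≠ 0) with hp
      set B := ((k, c) :: L).takeWhile p with hB
      set R := ((k, c) :: L).dropWhile p with hR
      have eBR : (k, c) :: L = B ++ R := (List.takeWhile_append_dropWhile).symm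
      have hBne : B ≠ [] := by
        rw [hB, List.takeWhile_cons_of_pos (by simp [hp, hk])]; simp
      have hBp : ∀ l ∈ B, l.1 ≠ 0 := fun l hl => by
        simpa [hp] using List.mem_takeWhile_imp hl
      have hlen := congrArg List.length eBR
      rw [List.length_append, List.length_cons] at hlen
      have hBpos := List.length_pos_of_ne_nil hBne
      have hBR : FreeGroup.IsReduced (B ++ R) := eBR ▸ hL
      have hBred : FreeGroup.IsReduced B := List.IsChain.left_of_append hBR
      have hRred : FreeGroup.IsReduced R := List.IsChain.right_of_append hBR
      have hRhead : ∀ l, R.head? = some l → l.1 = 0 := by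
        intro l hl
        have := List.head?_dropWhile_not p ((k, c) :: L)
        rw [← hR, hl] at this
        simpa [hp] using this
      have hV : ∀ l ∈ (f (mk B)).toWord, l.1 ≠ 0 := image_mem_avoidZero h hBp
      have hVne : (f (mk B)).toWord ≠ [] := by
        rw [Ne, toWord_eq_nil_iff, map_eq_one_iff f f.injective, ← toWord_eq_nil_iff,
          toWord_mk_of_isReduced hBred]
        exact hBne
      have hW : ∀ l, (f (mk R)).toWord.head? = some l → l.1 = 0 := by
        intro l hl
        rcases hRe : R with _ | ⟨⟨m, d⟩, R'⟩
        · rw [hRe, ← one_eq_mk, _root_.map_one] at hl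
          simp at hl
        · have hm : m = 0 := hRhead (m, d) (by rw [hRe]; rfl)
          subst hm
          rw [(ih R (by omega) hRred d).2 (by rw [hRe]; rfl)] at hl
          simpa using (congrArg Prod.fst (Option.some_injective _ hl)).symm
      have e : f (mk ((k, c) :: L)) = mk ((f (mk B)).toWord ++ (f (mk R)).toWord) := by
        rw [eBR, ← mul_mk, _root_.map_mul, ← mul_mk, mk_toWord, mk_toWord]
      rw [e, toWord_mk_of_isReduced]
      · obtain ⟨v, V, hv⟩ := List.exists_cons_of_ne_nil hVne
        rw [hv, List.cons_append, List.head?_cons, List.head?_cons]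
        have hv0 := hV v (by rw [hv]; exact List.mem_cons_self)
        constructor
        · intro h'; rw [Option.some_injective _ h'] at hv0; exact absurd rfl hv0
        · intro h'; exact absurd (congrArg Prod.fst (Option.some_injective _ h')) hk
      · refine List.isChain_append.2 ⟨isReduced_toWord, isReduced_toWord, fun x hx y hy hxy => ?_⟩
        exact absurd (hxy.trans (hW y hy)) (hV x (List.mem_of_mem_getLast? hx))

lemma startsZero_of_fix {f : MulAut (FreeGroup ℕ)} (h0 : f (of 0) = of 0)
    (h : ∀ k ≠ 0, f (of k) ∈ avoidZero) {w : FreeGroup ℕ} (hw : StartsZero w) :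
    StartsZero (f w) := by
  have := (head_image h0 h _ w.toWord le_rfl isReduced_toWord true).2 hw
  rwa [mk_toWord] at this

lemma artin_of_zero {i : ℕ} (hi : 1 ≤ i) : artin i (of 0) = of 0 := by
  rw [artin_of, artinFun, if_neg (by omega), if_neg (by omega)]

lemma artin_inv_of_zero {i : ℕ} (hi : 1 ≤ i) : (artin i)⁻¹ (of 0) = of 0 := by
  rw [artin_inv_of, artinInvFun, if_neg (by omega), if_neg (by omega)]

lemma artin_mem_avoidZero {i : ℕ} (hi : 1 ≤ i) {k : ℕ} (hk : k ≠ 0) :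
    artin i (of k) ∈ avoidZero := by
  have h1 : of i ∈ avoidZero := of_mem_avoidZero (by omega)
  have h2 : of (i + 1) ∈ avoidZero := of_mem_avoidZero (by omega)
  rw [artin_of, artinFun]
  split_ifs
  · exact mul_mem (mul_mem h1 h2) (inv_mem_avoidZero h1)
  · exact h1
  · exact of_mem_avoidZero hk

lemma artin_inv_mem_avoidZero {i : ℕ} (hi : 1 ≤ i) {k : ℕ} (hk : k ≠ 0) :
    (artin i)⁻¹ (of k) ∈ avoidZero := by
  have h1 : of i ∈ avoidZero := of_mem_avoidZero (by omega)
  have h2 : of (i + 1) ∈ avoidZero := of_mem_avoidZero (by omega)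
  rw [artin_inv_of, artinInvFun]
  split_ifs
  · exact h2
  · exact mul_mem (mul_mem (inv_mem_avoidZero h2) h1) h2
  · exact of_mem_avoidZero hk

lemma not_startsZero : ¬ StartsZero (of 0)⁻¹ := by
  simp [StartsZero, invRev]

lemma startsZero_artin_zero_inv : StartsZero (artin 0 (of 0)⁻¹) := by
  have : artin 0 (of 0)⁻¹ = mk [(0, true), (1, false), (0, false)] := by
    rw [_root_.map_inv, artin_of, mk_cons _ [_, _], mk_cons _ [_], mk_true, mk_false, mk_false]
    simp [artinFun, mul_assoc]
  rw [this, StartsZero, toWord_mk_of_isReduced]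
  · rfl
  · simp

end ArtinAction

namespace BraidOrder

open ArtinAction

variable {n : ℕ}

/-- The submonoid generated by `G₁` and `s_0`. -/
def Sbar (n : ℕ) : Submonoid (Braid n) :=
  Submonoid.closure ((G₁b n : Set (Braid n)) ∪ {gen n 0})

/-- The braids having a representative word that contains `s_0` but not `s_0⁻¹`. -/
def Spos (n : ℕ) : Set (Braid n) := {g | ∃ a ∈ Sbar n, ∃ b ∈ Sbar n, g = a * gen n 0 * b}

lemma mem_Sbar_of_G₁ {g : Braid n} (h : g ∈ G₁b n) : g ∈ Sbar n :=
  Submonoid.subset_closure (Or.inl h)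

lemma gen_zero_mem_Sbar : gen n 0 ∈ Sbar n := Submonoid.subset_closure (Or.inr rfl)

lemma Spos_mul_Sbar {g h : Braid n} (hg : g ∈ Spos n) (hh : h ∈ Sbar n) : g * h ∈ Spos n := by
  obtain ⟨a, ha, b, hb, rfl⟩ := hg
  exact ⟨a, ha, b * h, mul_mem hb hh, by group⟩

lemma Sbar_mul_Spos {g h : Braid n} (hg : g ∈ Sbar n) (hh : h ∈ Spos n) : g * h ∈ Spos n := by
  obtain ⟨a, ha, b, hb, rfl⟩ := hh
  exact ⟨g * a, mul_mem hg ha, b, hb, by group⟩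

lemma Spos_subset_Sbar {g : Braid n} (h : g ∈ Spos n) : g ∈ Sbar n := by
  obtain ⟨a, ha, b, hb, rfl⟩ := h
  exact mul_mem (mul_mem ha gen_zero_mem_Sbar) hb

lemma gen_zero_mem_Spos : gen n 0 ∈ Spos n := ⟨1, one_mem _, 1, one_mem _, by group⟩

lemma mem_Spos_or_G₁ {g : Braid n} (h : g ∈ Sbar n) : g ∈ Spos n ∨ g ∈ G₁b n := by
  induction h using Submonoid.closure_induction with
  | mem x hx =>
    rcases hx with hx | rfl
    · exact Or.inr hx
    · exact Or.inl gen_zero_mem_Spos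
  | one => exact Or.inr (one_mem _)
  | mul x y _ hy ihx ihy =>
    rcases ihx with h | h
    · exact Or.inl (Spos_mul_Sbar h hy)
    · rcases ihy with h' | h'
      · exact Or.inl (Sbar_mul_Spos (mem_Sbar_of_G₁ h) h')
      · exact Or.inr (mul_mem h h')

lemma gen_mem_G₁b {i : ℕ} (h : 1 ≤ i) : gen n i ∈ G₁b n := by
  by_cases hi : i < n
  · exact Subgroup.subset_closure ⟨i, h, hi, rfl⟩
  · rw [gen_of_le (by omega)]; exact one_mem _

lemma gen_mem_Sbar (i : ℕ) : gen n i ∈ Sbar n := by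
  rcases Nat.eq_zero_or_pos i with rfl | hi
  · exact gen_zero_mem_Sbar
  · exact mem_Sbar_of_G₁ (gen_mem_G₁b hi)

lemma Mb_le_Sbar : Mb n ≤ Sbar n := by
  refine Submonoid.closure_le.2 ?_
  rintro _ ⟨i, -, rfl⟩
  exact gen_mem_Sbar i

lemma action_of_mem_G₁ {g : Braid n} (h : g ∈ G₁b n) :
    action n g (FreeGroup.of 0)⁻¹ = (FreeGroup.of 0)⁻¹ ∧
    ∀ w, StartsZero w → StartsZero (action n g w) := by
  induction h using Subgroup.closure_induction'' with
  | mem x hx =>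
    obtain ⟨i, h1, h2, rfl⟩ := hx
    rw [action_gen h2]
    exact ⟨by rw [map_inv, artin_of_zero h1], fun w =>
      startsZero_of_fix (artin_of_zero h1) fun k => artin_mem_avoidZero h1⟩
  | inv_mem x hx =>
    obtain ⟨i, h1, h2, rfl⟩ := hx
    rw [map_inv (action n), action_gen h2]
    exact ⟨by rw [map_inv, artin_inv_of_zero h1], fun w =>
      startsZero_of_fix (artin_inv_of_zero h1) fun k => artin_inv_mem_avoidZero h1⟩
  | one => simp
  | mul x y _ _ hx hy =>
    rw [map_mul]
    refine ⟨?_, fun w hw => hx.2 _ (hy.2 w hw)⟩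
    rw [MulAut.mul_apply, hy.1, hx.1]

lemma startsZero_action_of_mem_Sbar (hn : 0 < n) {g : Braid n} (h : g ∈ Sbar n) :
    ∀ w, StartsZero w → StartsZero (action n g w) := by
  induction h using Submonoid.closure_induction with
  | mem x hx =>
    rcases hx with hx | rfl
    · exact (action_of_mem_G₁ hx).2
    · rw [action_gen hn]
      exact fun w => startsZero_artin_zero
  | one => simp
  | mul x y _ _ hx hy =>
    rw [map_mul]
    exact fun w hw => hx _ (hy w hw)

lemma startsZero_action_of_mem_Spos (hn : 0 < n) {g : Braid n} (h : g ∈ Spos n) :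
    StartsZero (action n g (FreeGroup.of 0)⁻¹) := by
  obtain ⟨a, ha, b, hb, rfl⟩ := h
  have key : ∀ b ∈ Sbar n, b ∈ G₁b n ∨ StartsZero (action n b (FreeGroup.of 0)⁻¹) := by
    intro b hb
    induction hb using Submonoid.closure_induction with
    | mem x hx =>
      rcases hx with hx | rfl
      · exact Or.inl hx
      · rw [action_gen hn]; exact Or.inr startsZero_artin_zero_inv
    | one => exact Or.inl (one_mem _)
    | mul x y hx _ ihx ihy =>
      rcases ihy with h | h
      · rcases ihx with h' | h'
        · exact Or.inl (mul_mem h' h)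
        · right
          rwa [map_mul, MulAut.mul_apply, (action_of_mem_G₁ h).1]
      · right
        rw [map_mul]
        exact startsZero_action_of_mem_Sbar hn hx _ h
  rw [map_mul, map_mul, MulAut.mul_apply, MulAut.mul_apply]
  refine startsZero_action_of_mem_Sbar hn ha _ ?_
  rw [action_gen hn]
  rcases key b hb with h | h
  · rw [(action_of_mem_G₁ h).1]; exact startsZero_artin_zero_inv
  · exact startsZero_artin_zero h

/-- Acyclicity: a braid with a representative word that contains `s_0` but not `s_0⁻¹` is not
in `G₁`. -/
lemma not_mem_G₁_of_mem_Spos (hn : 0 < n) {g : Braid n} (h : g ∈ Spos n) : g ∉ G₁b n := fun h' =>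
  not_startsZero (by
    simpa only [(action_of_mem_G₁ h').1] using startsZero_action_of_mem_Spos hn h)

lemma inv_not_mem_Sbar (hn : 0 < n) {g : Braid n} (h : g ∈ Spos n) : g⁻¹ ∉ Sbar n := fun h' =>
  not_mem_G₁_of_mem_Spos hn (Spos_mul_Sbar h h') (by rw [mul_inv_cancel]; exact one_mem _)

end BraidOrder

section HalfTwist

variable {T : Type*} [Monoid T] {n : ℕ} {s : ℕ → T}

/-- The half twist of the first `k` generators. -/
def half (s : ℕ → T) : ℕ → T
  | 0 => 1
  | k + 1 => half s k * dn s 0 (k + 1)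

lemma half_succ (k : ℕ) : half s (k + 1) = half s k * dn s 0 (k + 1) := rfl

lemma half_mem {N : Submonoid T} : ∀ {k : ℕ}, (∀ i < k, s i ∈ N) → half s k ∈ N
  | 0, _ => N.one_mem
  | _ + 1, h => N.mul_mem (half_mem fun i hi => h i (by omega)) (dn_mem fun i _ hi => h i (by omega))

lemma up_shift (a k : ℕ) : up (fun i => s (i + 1)) a k = up s (a + 1) k := by
  induction k with
  | zero => rfl
  | succ k ih => rw [up_succ, up_succ, ih, show a + 1 + k = a + k + 1 by ring]

lemma dn_shift (a k : ℕ) : dn (fun i => s (i + 1)) a k = dn s (a + 1) k := by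
  induction k with
  | zero => rfl
  | succ k ih => rw [dn_succ, dn_succ, ih, show a + 1 + k = a + k + 1 by ring]

namespace BraidSeq

lemma shift (hs : BraidSeq (n + 1) s) : BraidSeq n fun i => s (i + 1) where
  braid i hi := hs.braid (i + 1) (by omega)
  comm i j hij := hs.comm (i + 1) (j + 1) (by omega)

lemma mono (hs : BraidSeq n s) {k : ℕ} (h : k ≤ n) : BraidSeq k s where
  braid i hi := hs.braid i (by omega)
  comm := hs.comm

lemma commute_half (hs : BraidSeq n s) {i : ℕ} : ∀ {k : ℕ}, k + 1 ≤ i → Commute (s i) (half s k)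
  | 0, _ => Commute.one_right _
  | _ + 1, h => (hs.commute_half (by omega)).mul_right (hs.commute_dn (by omega))

lemma half_mul_gen (hs : BraidSeq n s) {k : ℕ} (hk : k ≤ n) {i : ℕ} (hi : i < k) :
    half s k * s i = s (k - 1 - i) * half s k := by
  induction k generalizing i with
  | zero => omega
  | succ k ih =>
    rcases i with _ | i
    · rcases k with _ | k
      · simp [half, dn]
      · have h1 : dn s 0 (k + 1) * dn s 0 (k + 1 + 1) = dn s 0 (k + 1 + 1) * dn s 1 (k + 1) :=
          hs.dn_mul_dn (by omega) (by omega) (by omega)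
        have h2 := (hs.commute_half (i := k + 1) (k := k) le_rfl).eq
        rw [half_succ, half_succ, mul_assoc _ (dn s 0 (k + 1)), h1, mul_assoc, mul_assoc,
          ← dn_succ', Nat.sub_zero, Nat.add_sub_cancel]
        conv_lhs => rw [dn_succ, zero_add]
        rw [← h1, mul_assoc, ← mul_assoc, ← h2, mul_assoc, dn_succ _ (k + 1), zero_add]
    · rw [half_succ, mul_assoc, ← hs.mul_dn (by omega) (by omega) (by omega), ← mul_assoc,
        ih (by omega) (by omega), mul_assoc, show k - 1 - i = k + 1 - 1 - (i + 1) by omega]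

lemma half_mul_dn (hs : BraidSeq n s) {a k : ℕ} (h : a + k ≤ n) :
    half s n * dn s a k = up s (n - a - k) k * half s n := by
  induction k with
  | zero => simp
  | succ k ih =>
    rw [dn_succ, ← mul_assoc, hs.half_mul_gen le_rfl (by omega), mul_assoc, ih (by omega),
      up_succ', ← mul_assoc]
    congr 3 <;> omega

lemma half_mul_up (hs : BraidSeq n s) {a k : ℕ} (h : a + k ≤ n) :
    half s n * up s a k = dn s (n - a - k) k * half s n := by
  induction k with
  | zero => simp
  | succ k ih =>
    rw [up_succ, ← mul_assoc, ih (by omega), mul_assoc, hs.half_mul_gen le_rfl (by omega),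
      dn_succ', ← mul_assoc]
    congr 2
    · congr 1; omega
    · congr 1; omega

/-- The half twist factors through the half twist of the shifted generators. -/
lemma half_eq_dn_mul (hs : BraidSeq (n + 1) s) :
    half s (n + 1) = dn s 0 (n + 1) * half (fun i => s (i + 1)) n := by
  rw [half_succ]
  have : ∀ k ≤ n, half s k * dn s 0 (n + 1) = dn s 0 (n + 1) * half (fun i => s (i + 1)) k := by
    intro k hk
    induction k with
    | zero => simp [half]
    | succ k ih =>
      rw [half_succ, mul_assoc, hs.dn_mul_dn (by omega) (by omega) (by omega), ← mul_assoc,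
        ih (by omega), half_succ, dn_shift, mul_assoc]
  exact this n le_rfl

lemma up_mul_dn (hs : BraidSeq n s) {j : ℕ} (hj : j < n) :
    up s 0 n * dn s 0 j = dn s 1 j * up s 0 n := by
  induction j with
  | zero => simp
  | succ j ih =>
    rw [dn_succ, ← mul_assoc, hs.up_mul (by omega) (by omega) (by omega), mul_assoc,
      ih (by omega), dn_succ, ← mul_assoc, show 1 + j = 0 + j + 1 by ring]

lemma up_pow (hs : BraidSeq (n + 1) s) {j : ℕ} (hj : j ≤ n + 1) :
    up s 0 (n + 1) ^ j = dn s 0 j * up s 1 n ^ j := by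
  induction j with
  | zero => simp
  | succ j ih =>
    rw [pow_succ', ih (by omega), ← mul_assoc, hs.up_mul_dn (by omega), up_succ', dn_succ',
      pow_succ', mul_assoc, mul_assoc, mul_assoc]

/-- The square of the half twist is the full twist. -/
lemma half_sq (hs : BraidSeq n s) : half s n * half s n = up s 0 n ^ (n + 1) := by
  induction n generalizing s with
  | zero => simp [half]
  | succ n ih =>
    have h := hs.half_mul_dn (a := 0) (k := n + 1) (by omega)
    have h2 := ih hs.shift
    rw [up_shift] at h2
    rw [zero_add] at h2
    rw [show n + 1 - 0 - (n + 1) = 0 by omega] at h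
    rw [pow_succ', hs.up_pow le_rfl, ← h2, ← mul_assoc (dn s 0 (n + 1)), ← hs.half_eq_dn_mul,
      ← mul_assoc, ← h, mul_assoc, ← hs.half_eq_dn_mul]

end BraidSeq

end HalfTwist

namespace BraidOrder

variable {n : ℕ}

lemma lenHom_rel (n : ℕ) : ∀ r ∈ braidRel n,
    FreeGroup.lift (fun _ : Fin n => Multiplicative.ofAdd (1 : ℤ)) r = 1 := by
  rintro r ⟨i, j, ⟨-, rfl⟩ | ⟨-, rfl⟩⟩ <;> simp

/-- The exponent sum of a braid. -/
def len (g : Braid n) : ℤ := Multiplicative.toAdd (PresentedGroup.toGroup (lenHom_rel n) g)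

lemma len_mul (g h : Braid n) : len (g * h) = len g + len h := by
  simp [len]

lemma len_inv (g : Braid n) : len g⁻¹ = -len g := by
  simp [len]

@[simp] lemma len_one : len (1 : Braid n) = 0 := by
  simp [len]

lemma len_gen {i : ℕ} (h : i < n) : len (gen n i) = 1 := by
  rw [show gen n i = _ from dif_pos h, len, PresentedGroup.toGroup.of]
  rfl

lemma len_nonneg {a : Braid n} (h : a ∈ Mb n) : 0 ≤ len a := by
  induction h using Submonoid.closure_induction with
  | mem x hx => obtain ⟨i, hi, rfl⟩ := hx; rw [len_gen hi]; norm_num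
  | one => simp
  | mul x y _ _ hx hy => rw [len_mul]; omega

/-- `s_i` left-divides `a`. -/
def LDvd (a : Braid n) (i : ℕ) : Prop := i < n ∧ (gen n i)⁻¹ * a ∈ Mb n

lemma exists_LDvd {a : Braid n} (h : a ∈ Mb n) (h1 : a ≠ 1) : ∃ i, LDvd a i := by
  induction h using Submonoid.closure_induction with
  | mem x hx =>
    obtain ⟨i, hi, rfl⟩ := hx
    exact ⟨i, hi, by simp⟩
  | one => exact absurd rfl h1
  | mul x y _ hy ihx ihy =>
    by_cases hx : x = 1
    · subst hx
      rw [one_mul] at h1 ⊢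
      exact ihy h1
    · obtain ⟨i, hi, h⟩ := ihx hx
      exact ⟨i, hi, by rw [← mul_assoc]; exact mul_mem h hy⟩

lemma LDvd.of_mul {b : Braid n} {i j : ℕ} {w : Braid n} (hi : i < n) (hw : w ∈ Mb n)
    (h : w * gen n j = gen n i * w) (hj : LDvd b j) : LDvd (w * b) i := by
  refine ⟨hi, ?_⟩
  have : (gen n i)⁻¹ * (w * b) = w * ((gen n j)⁻¹ * b) := by
    rw [inv_mul_eq_iff_eq_mul, ← mul_assoc, ← mul_assoc, ← h]
    group
  rw [this]
  exact mul_mem hw hj.2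

lemma dn_mem_Mb (a k : ℕ) : dn (gen n) a k ∈ Mb n := dn_mem fun i _ _ => gen_mem_Mb i

lemma up_mem_Mb (a k : ℕ) : up (gen n) a k ∈ Mb n := up_mem fun i _ _ => gen_mem_Mb i

lemma len_up {a k : ℕ} (h : a + k ≤ n) : len (up (gen n) a k) = k := by
  induction k with
  | zero => simp
  | succ k ih => rw [up_succ, len_mul, ih (by omega), len_gen (by omega)]; push_cast; ring

lemma len_dn {a k : ℕ} (h : a + k ≤ n) : len (dn (gen n) a k) = k := by
  induction k with
  | zero => simp
  | succ k ih => rw [dn_succ, len_mul, ih (by omega), len_gen (by omega)]; push_cast; ring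

lemma exists_dn_factor {a : Braid n} {q t : ℕ} (hqt : q ≤ t) (ht : LDvd a t)
    (hD : ∀ i, q ≤ i → i < t → ¬ LDvd a i) :
    ∃ l b, q ≤ l ∧ l ≤ t ∧ b ∈ Mb n ∧ a = dn (gen n) l (t + 1 - l) * b ∧
      ∀ j, q ≤ j → j ≤ t → LDvd b j → j = l := by
  classical
  have hex : ∃ l, q ≤ l ∧ l ≤ t ∧ (dn (gen n) l (t + 1 - l))⁻¹ * a ∈ Mb n := by
    refine ⟨t, hqt, le_rfl, ?_⟩
    rw [show t + 1 - t = 0 + 1 by omega, dn_succ]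
    simpa using ht.2
  obtain ⟨h1, h2, h3⟩ := Nat.find_spec hex
  have hmin : ∀ m, m < Nat.find hex → ¬ (q ≤ m ∧ m ≤ t ∧
    (dn (gen n) m (t + 1 - m))⁻¹ * a ∈ Mb n) := fun m => Nat.find_min hex
  generalize Nat.find hex = l at *
  refine ⟨l, _, h1, h2, h3, by group, fun j hj1 hj2 hj => ?_⟩
  by_contra hne
  have htn := ht.1
  have ea : a = dn (gen n) l (t + 1 - l) * ((dn (gen n) l (t + 1 - l))⁻¹ * a) := by group
  rcases Nat.lt_or_ge l j with hlj | hlj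
  · refine hD (j - 1) (by omega) (by omega) ?_
    rw [ea]
    refine LDvd.of_mul (by omega) (dn_mem_Mb _ _) ?_ hj
    have := (braidSeq_gen n).mul_dn (a := l) (i := j - 1) (k := t + 1 - l) (by omega) (by omega)
      (by omega)
    rw [this, show j - 1 + 1 = j by omega]
  · by_cases hl : j + 1 = l
    · subst hl
      refine hmin j (by omega) ⟨hj1, by omega, ?_⟩
      rw [show t + 1 - j = t + 1 - (j + 1) + 1 by omega, dn_succ', mul_inv_rev, mul_assoc]
      exact hj.2
    · refine hD j hj1 (by omega) ?_
      rw [ea]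
      exact LDvd.of_mul (by omega) (dn_mem_Mb _ _)
        ((braidSeq_gen n).commute_dn (by omega)).eq.symm hj

lemma exists_up_factor {a : Braid n} {q : ℕ} (hq : LDvd a q) :
    ∃ p b, q ≤ p ∧ p < n ∧ b ∈ Mb n ∧ a = up (gen n) q (p + 1 - q) * b ∧ ¬ LDvd b (p + 1) := by
  classical
  let P : ℕ → Prop := fun p => q ≤ p ∧ p < n ∧ (up (gen n) q (p + 1 - q))⁻¹ * a ∈ Mb n
  have hqn := hq.1
  have h0 : P q := by
    refine ⟨le_rfl, hqn, ?_⟩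
    rw [show q + 1 - q = 0 + 1 by omega, up_succ]
    simpa using hq.2
  obtain ⟨h1, h2, h3⟩ : P (Nat.findGreatest P (n - 1)) := Nat.findGreatest_spec (m := q) (by omega) h0
  refine ⟨_, _, h1, h2, h3, by group, fun h => ?_⟩
  have h4 := h.1
  refine Nat.findGreatest_is_greatest (P := P) (n := n - 1)
    (k := Nat.findGreatest P (n - 1) + 1) (by omega) (by omega) ⟨by omega, h4, ?_⟩
  generalize Nat.findGreatest P (n - 1) = p at *
  rw [show p + 1 + 1 - q = p + 1 - q + 1 by omega, up_succ, mul_inv_rev, mul_assoc,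
    show q + (p + 1 - q) = p + 1 by omega]
  exact h.2

/-- The half twist. -/
def htw (n : ℕ) : Braid n := half (gen n) n

lemma htw_mem_Mb : htw n ∈ Mb n := half_mem fun i _ => gen_mem_Mb i

lemma htw_mul_gen {i : ℕ} (h : i < n) : htw n * gen n i = gen n (n - 1 - i) * htw n :=
  (braidSeq_gen n).half_mul_gen le_rfl h

/-- Conjugation by the half twist. -/
def flip (n : ℕ) : MulAut (Braid n) := MulAut.conj (htw n)

lemma flip_apply (g : Braid n) : flip n g = htw n * g * (htw n)⁻¹ := rfl

lemma flip_mul_htw (g : Braid n) : flip n g * htw n = htw n * g := by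
  rw [flip_apply]; group

lemma flip_gen {i : ℕ} (h : i < n) : flip n (gen n i) = gen n (n - 1 - i) := by
  rw [flip_apply, htw_mul_gen h]; group

lemma len_flip (g : Braid n) : len (flip n g) = len g := by
  rw [flip_apply, len_mul, len_mul, len_inv]; ring

lemma flip_mem_Mb {a : Braid n} (h : a ∈ Mb n) : flip n a ∈ Mb n := by
  induction h using Submonoid.closure_induction with
  | mem x hx => obtain ⟨i, hi, rfl⟩ := hx; rw [flip_gen hi]; exact gen_mem_Mb _
  | one => simp
  | mul x y _ _ hx hy => rw [map_mul]; exact mul_mem hx hy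

lemma flip_flip (g : Braid n) : flip n (flip n g) = g := by
  have : (MulAut.conj (htw n)).toMonoidHom.comp (MulAut.conj (htw n)).toMonoidHom =
      MonoidHom.id (Braid n) := by
    refine PresentedGroup.ext fun i => ?_
    change flip n (flip n (PresentedGroup.of i)) = PresentedGroup.of i
    have := i.2
    rw [← gen_val, flip_gen i.2, flip_gen (by omega)]
    congr 1
    omega
  exact DFunLike.congr_fun this g

lemma LDvd.flip {a : Braid n} {i : ℕ} (h : LDvd (flip n a) i) : LDvd a (n - 1 - i) := by
  have h1 := h.1
  refine ⟨by omega, ?_⟩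
  have h2 := flip_mem_Mb h.2
  rwa [map_mul, map_inv, flip_flip, flip_gen h1] at h2

/-- The subgroup generated by `s_a, …, s_{b-1}`. -/
def par (n a b : ℕ) : Subgroup (Braid n) := Subgroup.closure {x | ∃ i, a ≤ i ∧ i < b ∧ x = gen n i}

lemma gen_mem_par {a b i : ℕ} (h1 : a ≤ i) (h2 : i < b) : gen n i ∈ par n a b :=
  Subgroup.subset_closure ⟨i, h1, h2, rfl⟩

lemma par_mono {a b c d : ℕ} (h1 : c ≤ a) (h2 : b ≤ d) : par n a b ≤ par n c d :=
  Subgroup.closure_mono (by rintro _ ⟨i, h, h', rfl⟩; exact ⟨i, by omega, by omega, rfl⟩)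

lemma dn_mem_par (a k : ℕ) : dn (gen n) a k ∈ par n a (a + k) :=
  dn_mem (N := (par n a (a + k)).toSubmonoid) fun _ h1 h2 => gen_mem_par h1 h2

lemma up_mem_par (a k : ℕ) : up (gen n) a k ∈ par n a (a + k) :=
  up_mem (N := (par n a (a + k)).toSubmonoid) fun _ h1 h2 => gen_mem_par h1 h2

lemma commute_par {a b i : ℕ} (h : i + 2 ≤ a ∨ b + 1 ≤ i) {g : Braid n} (hg : g ∈ par n a b) :
    Commute (gen n i) g := by
  have : par n a b ≤ Subgroup.centralizer {gen n i} := by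
    refine (Subgroup.closure_le _).2 ?_
    rintro _ ⟨j, h1, h2, rfl⟩
    rw [SetLike.mem_coe, Subgroup.mem_centralizer_singleton_iff]
    exact (braidSeq_gen n).far (by omega)
  exact (Subgroup.mem_centralizer_singleton_iff.1 (this hg)).symm

/-- Conjugation carrying generators into a subgroup carries the parabolic subgroup into it. -/
lemma conj_mem_of_par {a b : ℕ} {w : Braid n} {K : Subgroup (Braid n)}
    (h : ∀ i, a ≤ i → i < b → w * gen n i * w⁻¹ ∈ K) {g : Braid n} (hg : g ∈ par n a b) :
    w * g * w⁻¹ ∈ K := by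
  have : par n a b ≤ K.comap (MulAut.conj w).toMonoidHom := by
    refine (Subgroup.closure_le _).2 ?_
    rintro _ ⟨i, h1, h2, rfl⟩
    exact h i h1 h2
  exact this hg

end BraidOrder

namespace BraidOrder

variable {n : ℕ}

/-- A preordered set with a monotone action of the braid group and a base point that is fixed by
`s_i` for `i ≥ 1` and moved up by `s_0`. -/
structure OrderedAction (n : ℕ) {X : Type*} [Preorder X] [MulAction (Braid n) X] (o : X) :
    Prop where
  mono : ∀ (g : Braid n) {x y : X}, x ≤ y → g • x ≤ g • y
  fix : ∀ i, 1 ≤ i → gen n i • o = o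
  lt : o < gen n 0 • o

/-- The points `(s_0 ⋯ s_{q-1})⁻¹ • o`. -/
def upt (n : ℕ) {X : Type*} [MulAction (Braid n) X] (o : X) (q : ℕ) : X := (up (gen n) 0 q)⁻¹ • o

variable {X : Type*} [MulAction (Braid n) X] {o : X}

lemma smul_eq_of_par {a b : ℕ} {x : X} (h : ∀ i, a ≤ i → i < b → gen n i • x = x) {g : Braid n}
    (hg : g ∈ par n a b) : g • x = x := by
  have : par n a b ≤ MulAction.stabilizer (Braid n) x := by
    refine (Subgroup.closure_le _).2 ?_
    rintro _ ⟨i, h1, h2, rfl⟩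
    exact h i h1 h2
  exact this hg

lemma inv_smul_eq_of_smul_eq {g : Braid n} {x : X} (h : g • x = x) : g⁻¹ • x = x := by
  rw [inv_smul_eq_iff, h]

lemma upt_zero : upt n o 0 = o := by simp [upt]

lemma upt_succ (q : ℕ) : upt n o (q + 1) = (gen n q)⁻¹ • upt n o q := by
  rw [upt, upt, up_succ, mul_inv_rev, mul_smul, zero_add]

lemma gen_smul_upt_succ (q : ℕ) : gen n q • upt n o (q + 1) = upt n o q := by
  rw [upt_succ, smul_inv_smul]

variable [Preorder X]

/-- The points `h • o ≤ upt n o q` with `h` in the subgroup generated by `s_0, …, s_{q-1}`. -/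
def LowPt (n : ℕ) {X : Type*} [Preorder X] [MulAction (Braid n) X] (o : X) (q : ℕ) (Y : X) : Prop :=
  (∃ h ∈ par n 0 q, Y = h • o) ∧ Y ≤ upt n o q

namespace OrderedAction

lemma smul_le_iff (hX : OrderedAction n o) {g : Braid n} {x y : X} : g • x ≤ g • y ↔ x ≤ y :=
  ⟨fun h => by simpa using hX.mono g⁻¹ h, hX.mono g⟩

lemma smul_lt_iff (hX : OrderedAction n o) {g : Braid n} {x y : X} : g • x < g • y ↔ x < y := by
  rw [lt_iff_le_not_ge, lt_iff_le_not_ge, hX.smul_le_iff, hX.smul_le_iff]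

lemma inv_smul_le (hX : OrderedAction n o) {g : Braid n} {x y : X} : g⁻¹ • x ≤ y ↔ x ≤ g • y := by
  rw [← hX.smul_le_iff (g := g), smul_inv_smul]

lemma le_inv_smul (hX : OrderedAction n o) {g : Braid n} {x y : X} : x ≤ g⁻¹ • y ↔ g • x ≤ y := by
  rw [← hX.smul_le_iff (g := g), smul_inv_smul]

lemma le_gen_smul (hX : OrderedAction n o) (i : ℕ) : o ≤ gen n i • o := by
  rcases Nat.eq_zero_or_pos i with rfl | h
  · exact hX.lt.le
  · exact (hX.fix i h).ge

lemma le_smul_of_mem (hX : OrderedAction n o) {a : Braid n} (h : a ∈ Mb n) : o ≤ a • o := by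
  induction h using Submonoid.closure_induction with
  | mem x hx => obtain ⟨i, hi, rfl⟩ := hx; exact hX.le_gen_smul i
  | one => simp
  | mul x y _ _ hx hy => rw [mul_smul]; exact hx.trans (hX.mono x hy)

lemma par_smul (hX : OrderedAction n o) {a b : ℕ} (ha : 1 ≤ a) {g : Braid n} (hg : g ∈ par n a b) :
    g • o = o := smul_eq_of_par (fun i h _ => hX.fix i (by omega)) hg

lemma htw_smul (hX : OrderedAction n o) : htw n • o = dn (gen n) 0 n • o := by
  rcases n with _ | n
  · rfl
  · have : half (fun i => gen (n + 1) (i + 1)) n ∈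
        (MulAction.stabilizer (Braid (n + 1)) o).toSubmonoid :=
      half_mem fun i _ => hX.fix (i + 1) (by omega)
    rw [htw, (braidSeq_gen (n + 1)).half_eq_dn_mul, mul_smul]
    congr 1

lemma lt_dn_smul (hX : OrderedAction n o) {k : ℕ} (hk : 1 ≤ k) : o < dn (gen n) 0 k • o := by
  obtain ⟨k, rfl⟩ : ∃ j, k = j + 1 := ⟨k - 1, by omega⟩
  rw [dn_succ', mul_smul]
  conv_lhs => rw [← hX.par_smul (b := 0 + 1 + k) (by omega) (dn_mem_par (0 + 1) k)]
  exact hX.smul_lt_iff.2 hX.lt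

lemma htw_inv_lt (hX : OrderedAction n o) (hn : 1 ≤ n) : (htw n)⁻¹ • o < o := by
  rw [← hX.smul_lt_iff (g := htw n), smul_inv_smul, hX.htw_smul]
  exact hX.lt_dn_smul hn

lemma le_zpow_smul (hX : OrderedAction n o) {m : ℤ} (hm : m ≤ 0) : o ≤ htw n ^ (-m) • o := by
  obtain ⟨k, hk⟩ := Int.eq_ofNat_of_zero_le (show 0 ≤ -m by omega)
  rw [hk]
  exact_mod_cast hX.le_smul_of_mem (pow_mem htw_mem_Mb k)

lemma zpow_smul_lt (hX : OrderedAction n o) {m : ℤ} (hm : 1 ≤ m) :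
    htw n ^ (-m) • o ≤ (htw n)⁻¹ • o := by
  rw [show -m = -1 + (1 - m) by ring, zpow_add, zpow_neg_one, mul_smul, hX.smul_le_iff,
    ← neg_sub, zpow_neg, hX.inv_smul_le, ← neg_sub]
  exact hX.le_zpow_smul (by omega)

lemma gen_smul_upt_of_lt (hX : OrderedAction n o) {i q : ℕ} (h : q < i) :
    gen n i • upt n o q = upt n o q := by
  rw [upt, ← mul_smul, ((braidSeq_gen n).commute_up (by omega)).inv_right.eq, mul_smul,
    hX.fix i (by omega)]

lemma gen_smul_upt_of_gt (hX : OrderedAction n o) {i q : ℕ} (h : i + 1 < q) (hq : q ≤ n) :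
    gen n i • upt n o q = upt n o q := by
  have := (braidSeq_gen n).up_mul (a := 0) (i := i) (k := q) (by omega) (by omega) (by omega)
  have h2 : gen n i * (up (gen n) 0 q)⁻¹ = (up (gen n) 0 q)⁻¹ * gen n (i + 1) := by
    rw [eq_inv_mul_iff_mul_eq, ← mul_assoc, this]
    group
  rw [upt, ← mul_smul, h2, mul_smul, hX.fix _ (by omega)]

lemma upt_succ_lt (hX : OrderedAction n o) {q : ℕ} (hq : q < n) :
    upt n o (q + 1) < upt n o q := by
  induction q with
  | zero =>
    rw [← hX.smul_lt_iff (g := gen n 0), gen_smul_upt_succ, upt_zero]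
    exact hX.lt
  | succ q ih =>
    have hf : gen n (q + 1) • upt n o q = upt n o q := hX.gen_smul_upt_of_lt (by omega)
    have hb := (braidSeq_gen n).braid q (by omega)
    have e : gen n q * (gen n (q + 1))⁻¹ * (gen n q)⁻¹ =
        (gen n (q + 1))⁻¹ * (gen n q)⁻¹ * gen n (q + 1) := by
      rw [mul_inv_eq_iff_eq_mul, mul_inv_eq_iff_eq_mul, mul_assoc, mul_assoc, ← mul_assoc (gen n _),
        ← hb]
      group
    rw [← hX.smul_lt_iff (g := gen n q), gen_smul_upt_succ, upt_succ (q + 1), upt_succ q,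
      ← mul_smul, ← mul_smul, e, mul_smul, hf, mul_smul, ← upt_succ q,
      ← hX.smul_lt_iff (g := gen n (q + 1)), smul_inv_smul, hf]
    exact ih (by omega)

lemma upt_anti (hX : OrderedAction n o) {p q : ℕ} (h : p ≤ q) (hq : q ≤ n) :
    upt n o q ≤ upt n o p := by
  induction q, h using Nat.le_induction with
  | base => exact le_rfl
  | succ q h ih => exact (hX.upt_succ_lt (by omega)).le.trans (ih (by omega))

lemma upt_self (hX : OrderedAction n o) (hn : 1 ≤ n) : upt n o n = (htw n)⁻¹ • o := by
  obtain ⟨k, rfl⟩ : ∃ k, n = k + 1 := ⟨n - 1, by omega⟩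
  have e : htw (k + 1) = flip (k + 1) (half (gen (k + 1)) k) * up (gen (k + 1)) 0 (k + 1) := by
    have h1 : flip (k + 1) (htw (k + 1)) = htw (k + 1) := by rw [flip_apply]; group
    have h2 := (braidSeq_gen (k + 1)).half_mul_dn (a := 0) (k := k + 1) (by omega)
    conv_lhs => rw [← h1, htw, half_succ, map_mul]
    congr 1
    rw [flip_apply, htw, h2]
    simp
  have h3 : half (gen (k + 1)) k ∈
      ((MulAction.stabilizer (Braid (k + 1)) o).comap (flip (k + 1)).toMonoidHom).toSubmonoid := by
    refine half_mem fun i hi => ?_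
    change flip (k + 1) (gen (k + 1) i) • o = o
    rw [flip_gen (by omega)]
    exact hX.fix _ (by omega)
  have h4 : flip (k + 1) (half (gen (k + 1)) k) • o = o := h3
  rw [upt, e, mul_inv_rev, mul_smul, inv_smul_eq_of_smul_eq h4]

end OrderedAction

namespace LowPt

open OrderedAction

variable {q : ℕ} {Y : X}

lemma gen_smul (hX : OrderedAction n o) (hY : LowPt n o q Y) {k : ℕ} (hk : q < k) :
    gen n k • Y = Y := by
  obtain ⟨⟨h, hh, rfl⟩, -⟩ := hY
  rw [← mul_smul, (commute_par (by omega) hh).eq, mul_smul, hX.fix k (by omega)]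

lemma par_smul (hX : OrderedAction n o) (hY : LowPt n o q Y) {a b : ℕ} (ha : q < a) {g : Braid n}
    (hg : g ∈ par n a b) : g • Y = Y := smul_eq_of_par (fun i _ _ => hY.gen_smul hX (by omega)) hg

lemma upt_lt (hX : OrderedAction n o) (hY : LowPt n o q Y) (hq : q < n) : upt n o (q + 1) < Y := by
  obtain ⟨⟨h, hh, rfl⟩, -⟩ := hY
  have : h • upt n o (q + 1) = upt n o (q + 1) :=
    smul_eq_of_par (fun i _ _ => hX.gen_smul_upt_of_gt (by omega) (by omega)) hh
  rw [← this, hX.smul_lt_iff]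
  refine (hX.upt_succ_lt hq).trans_le ?_
  simpa only [upt_zero] using hX.upt_anti (Nat.zero_le q) hq.le

lemma base : LowPt n o 0 o := ⟨⟨1, one_mem _, by simp⟩, by rw [upt_zero]⟩

lemma inv_gen_smul (hX : OrderedAction n o) (hY : LowPt n o q Y) (hq : q ≤ n) {i : ℕ}
    (hi : i < q) : LowPt n o q ((gen n i)⁻¹ • Y) := by
  obtain ⟨⟨h, hh, rfl⟩, hle⟩ := hY
  refine ⟨⟨(gen n i)⁻¹ * h, mul_mem (inv_mem (gen_mem_par (by omega) hi)) hh, (mul_smul ..).symm⟩, ?_⟩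
  rw [hX.inv_smul_le]
  by_cases hi' : i + 1 < q
  · rwa [hX.gen_smul_upt_of_gt hi' hq]
  · obtain rfl : q = i + 1 := by omega
    rw [gen_smul_upt_succ]
    exact hle.trans (hX.upt_succ_lt (by omega)).le

lemma inv_gen_smul_self (hX : OrderedAction n o) (hY : LowPt n o q Y) :
    LowPt n o (q + 1) ((gen n q)⁻¹ • Y) := by
  obtain ⟨⟨h, hh, rfl⟩, hle⟩ := hY
  refine ⟨⟨(gen n q)⁻¹ * h, mul_mem (inv_mem (gen_mem_par (by omega) (by omega)))
    (par_mono le_rfl (by omega) hh), (mul_smul ..).symm⟩, ?_⟩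
  rw [upt_succ]
  exact hX.mono _ hle

lemma inv_up_smul (hX : OrderedAction n o) (hY : LowPt n o q Y) (k : ℕ) :
    LowPt n o (q + k) ((up (gen n) q k)⁻¹ • Y) := by
  induction k with
  | zero => simpa using hY
  | succ k ih =>
    rw [up_succ, mul_inv_rev, mul_smul]
    exact ih.inv_gen_smul_self hX

lemma upt_le_gen_smul (hX : OrderedAction n o) (hY : LowPt n o q Y) (hq : q < n) :
    upt n o q ≤ gen n q • Y := by
  rw [← gen_smul_upt_succ]
  exact hX.mono _ (hY.upt_lt hX hq).le

lemma smul_le_dn (hX : OrderedAction n o) (hY : LowPt n o q Y) {k : ℕ} (hk : q + k < n)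
    {g : Braid n} (hg : g ∈ par n q (q + k)) : g • Y ≤ dn (gen n) q (k + 1) • Y := by
  have h1 : g • dn (gen n) q (k + 1) • Y = dn (gen n) q (k + 1) • Y := by
    refine smul_eq_of_par (fun i hi1 hi2 => ?_) hg
    rw [← mul_smul, (braidSeq_gen n).mul_dn hi1 (by omega) (by omega), mul_smul,
      hY.gen_smul hX (by omega)]
  rw [← h1, hX.smul_le_iff, dn_succ', mul_smul]
  refine hY.2.trans ?_
  have h2 : dn (gen n) (q + 1) k • upt n o q = upt n o q :=
    smul_eq_of_par (fun i hi _ => hX.gen_smul_upt_of_lt (by omega)) (dn_mem_par (q + 1) k)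
  conv_lhs => rw [← h2]
  exact hX.mono _ (hY.upt_le_gen_smul hX (by omega))

lemma smul_le_upt (hX : OrderedAction n o) (hY : LowPt n o (q + 1) Y) (hq : q < n) {b : ℕ}
    {g : Braid n} (hg : g ∈ par n (q + 1) b) : g • Y ≤ upt n o q := by
  have : g • upt n o q = upt n o q :=
    smul_eq_of_par (fun i hi _ => hX.gen_smul_upt_of_lt (by omega)) hg
  rw [← this]
  exact hX.mono _ (hY.2.trans (hX.upt_succ_lt hq).le)

end LowPt

end BraidOrder

namespace BraidOrder

namespace OrderedAction

variable {n : ℕ} {X : Type*} [MulAction (Braid n) X] [Preorder X] {o : X}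

lemma htw_smul_inv_up_smul_upt (hX : OrderedAction n o) {q r : ℕ} (hr : q + (r + 1) = n) :
    htw n • (up (gen n) q (r + 1))⁻¹ • upt n o (q + 1) = dn (gen n) 1 r • upt n o 1 := by
  have h1 := (braidSeq_gen n).half_mul_up (a := q) (k := r + 1) hr.le
  have h2 := (braidSeq_gen n).half_mul_up (a := 0) (k := q + 1) (by omega)
  rw [show n - q - (r + 1) = 0 by omega] at h1
  rw [show n - 0 - (q + 1) = r by omega] at h2
  have e1 : htw n * (up (gen n) q (r + 1))⁻¹ = (dn (gen n) 0 (r + 1))⁻¹ * htw n := by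
    rw [mul_inv_eq_iff_eq_mul, mul_assoc, eq_inv_mul_iff_mul_eq]; exact h1.symm
  have e2 : htw n * (up (gen n) 0 (q + 1))⁻¹ = (dn (gen n) r (q + 1))⁻¹ * htw n := by
    rw [mul_inv_eq_iff_eq_mul, mul_assoc, eq_inv_mul_iff_mul_eq]; exact h2.symm
  have e3 : dn (gen n) 0 r * dn (gen n) 0 (r + 1) = dn (gen n) 0 (r + 1) * dn (gen n) 1 r :=
    (braidSeq_gen n).dn_mul_dn (by omega) (by omega) (by omega)
  have e4 : dn (gen n) 0 n = dn (gen n) r (q + 1) * dn (gen n) 0 r := by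
    rw [show n = r + (q + 1) by omega, dn_add, zero_add]
  have e5 : dn (gen n) 1 r • o = o := hX.par_smul le_rfl (dn_mem_par 1 r)
  rw [← mul_smul, e1, mul_smul, upt, ← mul_smul (htw n), e2, mul_smul, hX.htw_smul, e4, mul_smul,
    inv_smul_smul, inv_smul_eq_iff, ← mul_smul, ← e3, upt_succ, upt_zero, dn_succ', mul_smul,
    mul_smul, smul_inv_smul, zero_add, e5]

/-- The claim of the key lemma for all positive braids of length less than `L`. -/
def KeyBelow (n L : ℕ) {X : Type*} [MulAction (Braid n) X] [Preorder X] (o : X) : Prop :=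
  ∀ a ∈ Mb n, len a < L → ∀ (q t : ℕ) (Y : X) (m : ℤ), q < t → t ≤ n → LowPt n o q Y →
    (q = 0 → 1 ≤ m ∨ m = 0 ∧ o < a • htw n ^ (-m) • o) → Y ≤ a • htw n ^ (-m) • o →
    (∀ i, q ≤ i → i < t → ¬ LDvd a i) → ∀ g ∈ par n q t, g • Y ≤ a • htw n ^ (-m) • o

variable {L : ℕ} {a : Braid n} {q t : ℕ} {Y : X} {m : ℤ}

lemma key_one (hX : OrderedAction n o) (hqt : q < t) (htn : t ≤ n) (hY : LowPt n o q Y)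
    (hm : q = 0 → 1 ≤ m ∨ m = 0 ∧ o < htw n ^ (-m) • o) (hle : Y ≤ htw n ^ (-m) • o)
    {g : Braid n} (hg : g ∈ par n q t) : g • Y ≤ htw n ^ (-m) • o := by
  by_cases h1 : 1 ≤ m
  · have h2 := hX.upt_anti (p := q + 1) (q := n) (by omega) le_rfl
    rw [hX.upt_self (by omega)] at h2
    exact absurd ((hY.upt_lt hX (by omega)).trans_le (hle.trans ((hX.zpow_smul_lt h1).trans h2)))
      (lt_irrefl _)
  · rcases Nat.eq_zero_or_pos q with rfl | hq
    · rcases hm rfl with h | ⟨rfl, h⟩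
      · exact absurd h h1
      · simp at h
    · obtain ⟨p, rfl⟩ : ∃ p, q = p + 1 := ⟨q - 1, by omega⟩
      refine (hY.smul_le_upt hX (by omega) hg).trans ?_
      refine (hX.upt_anti (Nat.zero_le p) (by omega)).trans ?_
      rw [upt_zero]
      exact hX.le_zpow_smul (by omega)

lemma key_far (hX : OrderedAction n o) (ih : KeyBelow n L o) (hL : len a < L + 1)
    (hqt : q < t) (htn : t ≤ n) (hY : LowPt n o q Y)
    (hm : q = 0 → 1 ≤ m ∨ m = 0 ∧ o < a • htw n ^ (-m) • o) (hle : Y ≤ a • htw n ^ (-m) • o)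
    (hD : ∀ i, q ≤ i → i < t → ¬ LDvd a i) {g : Braid n} (hg : g ∈ par n q t) {i : ℕ}
    (hi : t < i) (hai : LDvd a i) : g • Y ≤ a • htw n ^ (-m) • o := by
  obtain ⟨b, hb, rfl⟩ : ∃ b ∈ Mb n, a = gen n i * b := ⟨_, hai.2, by group⟩
  have hin := hai.1
  rw [len_mul, len_gen hin] at hL
  have hYi : gen n i • Y = Y := hY.gen_smul hX (by omega)
  rw [mul_smul] at hm hle ⊢
  have key := ih b hb (by omega) q t Y m hqt htn hY
    (fun h => (hm h).imp_right fun h' => ⟨h'.1, by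
      rw [← hX.smul_lt_iff (g := gen n i), hX.fix i (by omega)]; exact h'.2⟩)
    (by rwa [← hX.smul_le_iff (g := gen n i), hYi])
    (fun j h1 h2 hj => hD j h1 h2
      (hj.of_mul (by omega) (gen_mem_Mb i) ((braidSeq_gen n).far (by omega)))) g hg
  have := hX.mono (gen n i) key
  rwa [← mul_smul, (commute_par (by omega) hg).eq, mul_smul, hYi] at this

lemma key_top (hX : OrderedAction n o) (ih : KeyBelow n L o) (hL : len a < L + 1)
    (hqt : q < t) (hY : LowPt n o q Y)
    (hm : q = 0 → 1 ≤ m ∨ m = 0 ∧ o < a • htw n ^ (-m) • o) (hle : Y ≤ a • htw n ^ (-m) • o)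
    (hD : ∀ i, q ≤ i → i < t → ¬ LDvd a i) {g : Braid n} (hg : g ∈ par n q t)
    (hat : LDvd a t) : g • Y ≤ a • htw n ^ (-m) • o := by
  have htn := hat.1
  obtain ⟨l, b, hql, hlt, hb, rfl, hbD⟩ := exists_dn_factor hqt.le hat hD
  rw [len_mul, len_dn (by omega)] at hL
  have hlb : len b < L := by omega
  obtain ⟨k, rfl⟩ : ∃ k, t = q + k := ⟨t - q, by omega⟩
  rw [mul_smul] at hm hle ⊢
  rcases hql.lt_or_eq with hql | rfl
  · have hw : ∀ {Z : X}, (∀ i, q < i → gen n i • Z = Z) →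
        (dn (gen n) l (q + k + 1 - l)) • Z = Z := fun hZ =>
      smul_eq_of_par (fun i hi _ => hZ i (by omega)) (dn_mem_par _ _)
    have key := ih b hb hlb q l Y m hql (by omega) hY
      (fun h => (hm h).imp_right fun h' => ⟨h'.1, by
        rw [← hX.smul_lt_iff (g := dn (gen n) l (q + k + 1 - l)),
          hw fun i hi => hX.fix i (by omega)]
        exact h'.2⟩)
      (by rwa [← hX.smul_le_iff (g := dn (gen n) l (q + k + 1 - l)),
        hw fun i hi => hY.gen_smul hX hi])
      (fun j h1 h2 hj => absurd (hbD j h1 (by omega) hj) (by omega))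
      (dn (gen n) q (l - q)) (par_mono le_rfl (by omega) (dn_mem_par q (l - q)))
    refine (hY.smul_le_dn hX htn hg).trans ?_
    have := hX.mono (dn (gen n) l (q + k + 1 - l)) key
    have hsplit : dn (gen n) q (k + 1) =
        dn (gen n) l (q + k + 1 - l) * dn (gen n) q (l - q) := by
      obtain ⟨d, rfl⟩ : ∃ d, l = q + d := ⟨l - q, by omega⟩
      rw [show k + 1 = d + (q + k + 1 - (q + d)) by omega, dn_add, Nat.add_sub_cancel_left]
    rwa [← mul_smul, ← hsplit] at this
  · rw [show q + k + 1 - q = k + 1 by omega] at *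
    have hw : (dn (gen n) q (k + 1))⁻¹ • Y = (gen n q)⁻¹ • Y := by
      rw [dn_succ', mul_inv_rev, mul_smul, inv_smul_eq_of_smul_eq
        (hY.par_smul hX (Nat.lt_succ_self q) (dn_mem_par (q + 1) k))]
    have hg' : (dn (gen n) q (k + 1))⁻¹ * g * (dn (gen n) q (k + 1))⁻¹⁻¹ ∈
        par n (q + 1) (q + k + 1) := by
      refine conj_mem_of_par (fun i h1 h2 => ?_) hg
      rw [inv_inv, mul_assoc, (braidSeq_gen n).mul_dn h1 (by omega) (by omega), inv_mul_cancel_left]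
      exact gen_mem_par (by omega) (by omega)
    have key := ih b hb hlb (q + 1) (q + k + 1) ((gen n q)⁻¹ • Y) m (by omega) (by omega)
      (hY.inv_gen_smul_self hX) (by omega) (by rwa [← hw, hX.inv_smul_le])
      (fun j h1 h2 hj => absurd (hbD j (by omega) (by omega) hj) (by omega)) _ hg'
    have := hX.mono (dn (gen n) q (k + 1)) key
    rw [← hw, ← mul_smul, ← mul_smul] at this
    convert this using 2
    group

/-- The case where all left divisors of `a` have index less than `q`, one of them less than
`q - 1`. -/
lemma key_low (hX : OrderedAction n o) (ih : KeyBelow n L o) (hL : len a < L + 1)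
    (hqt : q < t) (htn : t ≤ n) (hY : LowPt n o q Y) (hle : Y ≤ a • htw n ^ (-m) • o)
    (hD : ∀ i, q ≤ i → i < t → ¬ LDvd a i) {g : Braid n} (hg : g ∈ par n q t) {i : ℕ}
    (hi : i + 1 < q) (hai : LDvd a i) : g • Y ≤ a • htw n ^ (-m) • o := by
  obtain ⟨b, hb, rfl⟩ : ∃ b ∈ Mb n, a = gen n i * b := ⟨_, hai.2, by group⟩
  rw [len_mul, len_gen hai.1] at hL
  rw [mul_smul] at hle ⊢
  have key := ih b hb (by omega) q t _ m hqt htn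
    (hY.inv_gen_smul hX (by omega) (by omega : i < q)) (by omega) (hX.inv_smul_le.2 hle)
    (fun j h1 h2 hj => hD j h1 h2
      (hj.of_mul (by omega) (gen_mem_Mb i) ((braidSeq_gen n).far (by omega)))) g hg
  have := hX.mono (gen n i) key
  rwa [← mul_smul, (commute_par (by omega) hg).eq, mul_smul, smul_inv_smul] at this

lemma key_up_lt (hX : OrderedAction n o) (ih : KeyBelow n L o) {b : Braid n} (hb : b ∈ Mb n)
    (hL : len b < L) {k : ℕ} (hk : q + 1 + (k + 1) ≤ n) (hY : LowPt n o (q + 1) Y)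
    (hle : Y ≤ (up (gen n) q (k + 1) * b) • htw n ^ (-m) • o) (hbD : ¬ LDvd b (q + (k + 1)))
    {g : Braid n} (hg : g ∈ par n (q + 1) t) :
    g • Y ≤ (up (gen n) q (k + 1) * b) • htw n ^ (-m) • o := by
  have hY' : LowPt n o (q + 1 + k) ((up (gen n) q (k + 1))⁻¹ • Y) := by
    rw [up_succ', mul_inv_rev, mul_smul]
    exact (hY.inv_gen_smul hX (by omega) (Nat.lt_succ_self q)).inv_up_smul hX k
  rw [mul_smul] at hle ⊢
  have key := ih b hb hL (q + 1 + k) (q + 1 + (k + 1)) _ m (by omega) hk hY' (by omega)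
    (hX.inv_smul_le.2 hle) (fun i h1 h2 h => hbD (by rwa [show q + (k + 1) = i by omega])) _
    (gen_mem_par (i := q + (k + 1)) (by omega) (by omega))
  refine (hY.smul_le_upt hX (by omega) hg).trans ?_
  refine le_trans ?_ (hX.mono _ key)
  have e : up (gen n) (q + 1) (k + 1) * (up (gen n) q (k + 1) * gen n (q + (k + 1))) =
      up (gen n) q (k + 1 + 1) * up (gen n) q (k + 1) := by
    rw [← up_succ]
    exact ((braidSeq_gen n).up_mul_up le_rfl (by omega) (by omega)).symm
  have hf : up (gen n) (q + 1) (k + 1) • upt n o q = upt n o q :=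
    smul_eq_of_par (fun i hi _ => hX.gen_smul_upt_of_lt (by omega)) (up_mem_par (q + 1) (k + 1))
  rw [← hX.smul_le_iff (g := up (gen n) (q + 1) (k + 1)), hf, ← mul_smul, ← mul_smul, mul_assoc, e,
    mul_smul, smul_inv_smul, up_succ', up_succ', mul_smul, mul_smul,
    hY.par_smul hX (Nat.lt_succ_self _) (up_mem_par (q + 1 + 1) k), ← hX.inv_smul_le, ← upt_succ]
  exact hY.upt_le_gen_smul hX (by omega)

lemma key_up_eq (hX : OrderedAction n o) (ih : KeyBelow n L o) {b : Braid n} (hb : b ∈ Mb n)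
    (hL : len b < L) {k : ℕ} (hk : q + 1 + (k + 1) = n) (hY : LowPt n o (q + 1) Y)
    (hle : Y ≤ (up (gen n) q (k + 1 + 1) * b) • htw n ^ (-m) • o)
    (hD : ∀ i, q + 1 ≤ i → i < n → ¬ LDvd (up (gen n) q (k + 1 + 1) * b) i)
    {g : Braid n} (hg : g ∈ par n (q + 1) n) :
    g • Y ≤ (up (gen n) q (k + 1 + 1) * b) • htw n ^ (-m) • o := by
  set w := up (gen n) q (k + 1 + 1) with hw
  have hbD : ∀ i, q ≤ i → i + 1 < n → ¬ LDvd b i := fun i h1 h2 h => hD (i + 1) (by omega) h2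
    (h.of_mul h2 (up_mem_Mb _ _) ((braidSeq_gen n).up_mul h1 (by omega) h2))
  have hb'D : ∀ i, 1 ≤ i → i < k + 2 → ¬ LDvd (flip n b) i := fun i h1 h2 h =>
    hbD (n - 1 - i) (by omega) (by omega) h.flip
  have hx : flip n b • htw n ^ (-(m - 1)) • o = htw n • b • htw n ^ (-m) • o := by
    rw [show -(m - 1) = 1 + -m by ring, zpow_add, zpow_one, mul_smul, ← mul_smul (flip n b),
      flip_mul_htw, mul_smul]
  have hu : LowPt n o 1 (upt n o 1) := by
    simpa [upt_succ, upt_zero] using (LowPt.base (n := n) (o := o)).inv_gen_smul_self hX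
  have hlow : dn (gen n) 1 k • upt n o 1 ≤ htw n • w⁻¹ • Y := by
    rw [← hX.htw_smul_inv_up_smul_upt (q := q + 1) (r := k) hk, hX.smul_le_iff, hw,
      up_succ' q, mul_inv_rev, mul_smul, hX.smul_le_iff, hX.le_inv_smul,
      hX.gen_smul_upt_of_gt (by omega) (by omega)]
    exact (hY.upt_lt hX (by omega)).le
  have hupp : htw n • w⁻¹ • Y ≤ dn (gen n) 1 (k + 1) • upt n o 1 := by
    rw [← hX.htw_smul_inv_up_smul_upt (q := q) (r := k + 1) (by omega), hX.smul_le_iff, hw,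
      hX.smul_le_iff]
    exact hY.2
  have hbase : upt n o 1 ≤ dn (gen n) 1 k • upt n o 1 := by
    rcases k with _ | k
    · simp
    · simpa using hu.smul_le_dn hX (k := k) (by omega) (one_mem _)
  rw [mul_smul] at hle ⊢
  have key := ih (flip n b) (flip_mem_Mb hb) (by rwa [len_flip]) 1 (k + 2) (upt n o 1) (m - 1)
    (by omega) (by omega) hu (by omega)
    (by rw [hx]; exact hbase.trans (hlow.trans (hX.mono _ (hX.inv_smul_le.2 hle)))) hb'D
  have hg' : (htw n * w⁻¹) * g * (htw n * w⁻¹)⁻¹ ∈ par n 1 (k + 2) := by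
    refine conj_mem_of_par (fun i h1 h2 => ?_) hg
    obtain ⟨j, rfl⟩ : ∃ j, i = j + 1 := ⟨i - 1, by omega⟩
    have e : w * gen n j = gen n (j + 1) * w :=
      (braidSeq_gen n).up_mul (by omega) (by omega) (by omega)
    have e2 : htw n * w⁻¹ * gen n (j + 1) * (htw n * w⁻¹)⁻¹ = flip n (gen n j) := by
      rw [flip_apply, show gen n (j + 1) = w * gen n j * w⁻¹ by rw [e]; group]
      group
    rw [e2, flip_gen (by omega)]
    exact gen_mem_par (by omega) (by omega)
  have h1 := key _ (mul_mem hg' (par_mono le_rfl (by omega) (dn_mem_par 1 (k + 1))))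
  rw [hx, mul_smul] at h1
  rw [← hX.inv_smul_le, ← hX.smul_le_iff (g := htw n)]
  refine le_trans (le_of_eq ?_) ((hX.mono _ hupp).trans h1)
  simp only [mul_smul, mul_inv_rev, inv_inv, inv_smul_smul, smul_inv_smul]

/-- The key lemma. -/
lemma keyBelow (hX : OrderedAction n o) (L : ℕ) : KeyBelow n L o := by
  induction L with
  | zero =>
    intro a ha hL
    have := len_nonneg ha
    push_cast at hL
    omega
  | succ L ih =>
    intro a ha hL q t Y m hqt htn hY hm hle hD g hg
    push_cast at hL
    by_cases h1 : a = 1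
    · subst h1
      simp only [one_smul] at hm hle ⊢
      exact hX.key_one hqt htn hY hm hle hg
    by_cases h2 : ∃ i, t < i ∧ LDvd a i
    · obtain ⟨i, hi, hai⟩ := h2
      exact hX.key_far ih hL hqt htn hY hm hle hD hg hi hai
    by_cases h3 : LDvd a t
    · exact hX.key_top ih hL hqt hY hm hle hD hg h3
    have hD' : ∀ i, q ≤ i → ¬ LDvd a i := by
      intro i hi h
      rcases lt_trichotomy i t with h' | rfl | h'
      · exact hD i hi h' h
      · exact h3 h
      · exact h2 ⟨i, h', h⟩
    obtain ⟨i, hi⟩ := exists_LDvd ha h1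
    have hiq : i < q := by
      by_contra h
      exact hD' i (by omega) hi
    by_cases h4 : i + 1 < q
    · exact hX.key_low ih hL hqt htn hY hle hD hg h4 hi
    obtain rfl : q = i + 1 := by omega
    obtain ⟨p, b, h5, h6, hb, rfl, hbD⟩ := exists_up_factor hi
    obtain ⟨k, rfl⟩ : ∃ k, p = i + k := ⟨p - i, by omega⟩
    rw [len_mul, len_up (by omega)] at hL
    rw [show i + k + 1 - i = k + 1 by omega] at *
    rcases Nat.lt_or_ge (i + k + 1) n with h | h
    · exact hX.key_up_lt ih hb (by omega) (by omega) hY hle hbD hg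
    · obtain ⟨k, rfl⟩ : ∃ j, k = j + 1 := ⟨k - 1, by omega⟩
      exact hX.key_up_eq ih hb (by omega) (by omega) hY hle (fun i h _ => hD' i h)
        (par_mono le_rfl htn hg)

lemma key (hX : OrderedAction n o) {k : ℕ} (hk : 1 ≤ k) (hkn : k ≤ n) (ha : a ∈ Mb n) {m : ℕ}
    (hm : m = 0 → o < a • htw n ^ (-(m : ℤ)) • o) (hle : o ≤ a • htw n ^ (-(m : ℤ)) • o)
    (hD : ∀ i < k, ¬ LDvd a i) : dn (gen n) 0 k • o ≤ a • htw n ^ (-(m : ℤ)) • o := by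
  have h0 := len_nonneg ha
  refine hX.keyBelow ((len a).toNat + 1) a ha (by push_cast; omega) 0 k o m hk hkn LowPt.base
    (fun _ => ?_) hle (fun i _ hi => hD i hi) _ (par_mono le_rfl (by omega) (dn_mem_par 0 k))
  rcases Nat.eq_zero_or_pos m with rfl | h
  · exact Or.inr ⟨rfl, hm rfl⟩
  · exact Or.inl (by omega)

/-- If only `s_{n-1}` left-divides `a` and `a • δ^{-m} • o` lies above `o` then it lies above
`δ • o`. -/
theorem htw_smul_le (hX : OrderedAction n o) (hn : 2 ≤ n) (L : ℕ) (ha : a ∈ Mb n) (hL : len a < L)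
    {m : ℕ} (hm : m = 0 → o < a • htw n ^ (-(m : ℤ)) • o) (hle : o ≤ a • htw n ^ (-(m : ℤ)) • o)
    (hD : ∀ i, LDvd a i → i = n - 1) : htw n • o ≤ a • htw n ^ (-(m : ℤ)) • o := by
  induction L generalizing a m with
  | zero =>
    have := len_nonneg ha
    push_cast at hL
    omega
  | succ L ih =>
    by_cases h1 : a = 1
    · subst h1
      rw [one_smul] at hm hle
      exfalso
      rcases Nat.eq_zero_or_pos m with rfl | h
      · simpa using hm rfl
      · exact lt_irrefl _ ((hX.htw_inv_lt (by omega)).trans_le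
          (hle.trans (hX.zpow_smul_lt (by omega))))
    obtain ⟨i, hi⟩ := exists_LDvd ha h1
    obtain rfl := hD i hi
    obtain ⟨l, b, -, hl, hb, rfl, hbD⟩ := exists_dn_factor (Nat.zero_le _) hi
      (fun i _ h h' => absurd (hD i h') (by omega))
    rw [show n - 1 + 1 - l = n - l by omega] at *
    rw [len_mul, len_dn (by omega)] at hL
    push_cast at hL
    rw [mul_smul] at hm hle ⊢
    rw [hX.htw_smul]
    rcases Nat.eq_zero_or_pos l with rfl | hl0
    · rw [Nat.sub_zero, hX.smul_le_iff]
      rcases Nat.eq_zero_or_pos m with rfl | hm0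
      · simpa using hX.le_smul_of_mem hb
      · obtain ⟨m, rfl⟩ : ∃ j, m = j + 1 := ⟨m - 1, by omega⟩
        have hx : flip n b • htw n ^ (-(m : ℤ)) • o = htw n • b • htw n ^ (-((m + 1 : ℕ) : ℤ)) • o := by
          rw [show -(m : ℤ) = 1 + -((m + 1 : ℕ) : ℤ) by push_cast; ring, zpow_add, zpow_one, mul_smul,
            ← mul_smul (flip n b), flip_mul_htw, mul_smul]
        have hlt : o < flip n b • htw n ^ (-(m : ℤ)) • o := by
          rw [hx, ← hX.smul_lt_iff (g := (htw n)⁻¹), inv_smul_smul, ← hX.upt_self (by omega)]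
          refine lt_of_le_of_lt (hX.upt_anti hn le_rfl)
            ((hX.upt_succ_lt (q := 1) (by omega)).trans_le ?_)
          obtain ⟨j, rfl⟩ : ∃ j, n = j + 1 := ⟨n - 1, by omega⟩
          rw [upt_succ, upt_zero, hX.inv_smul_le]
          have := hX.inv_smul_le.2 hle
          have hf : dn (gen (j + 1)) (0 + 1) j • o = o := hX.par_smul le_rfl (dn_mem_par _ _)
          rwa [Nat.sub_zero, dn_succ', mul_inv_rev, mul_smul, inv_smul_eq_of_smul_eq hf,
            hX.inv_smul_le] at this
        have := ih (flip_mem_Mb hb) (by rw [len_flip]; omega) (fun _ => hlt) hlt.le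
          (fun i hi => by
            have h1 := hi.1
            have := hbD _ (Nat.zero_le _) (by omega) hi.flip
            omega)
        rwa [hx, hX.smul_le_iff] at this
    · have hf : dn (gen n) l (n - l) • o = o := hX.par_smul hl0 (dn_mem_par _ _)
      have hlt : ∀ {x : X}, o ≤ dn (gen n) l (n - l) • x → o ≤ x := fun h => by
        rwa [← hX.inv_smul_le, inv_smul_eq_of_smul_eq hf] at h
      have := hX.key hl0 (by omega) hb (m := m)
        (fun h => by rw [← hX.smul_lt_iff (g := dn (gen n) l (n - l)), hf]; exact hm h) (hlt hle)
        (fun i hi h => absurd (hbD i (Nat.zero_le _) (by omega) h) (by omega))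
      have e : dn (gen n) 0 n = dn (gen n) l (n - l) * dn (gen n) 0 l := by
        have := dn_add (s := gen n) 0 l (n - l)
        rwa [zero_add, show l + (n - l) = n by omega] at this
      rw [e, mul_smul]
      exact hX.mono _ this

end OrderedAction

end BraidOrder

namespace BraidOrder

variable {n : ℕ}

/-- The preorder on `G / G₁` whose elements above the base point are the cosets of `Sbar`. -/
@[reducible] def cosetPreorder (n : ℕ) : Preorder (Braid n ⧸ G₁b n) where
  le x y := ∃ g h : Braid n, (g : Braid n ⧸ G₁b n) = x ∧ (h : Braid n ⧸ G₁b n) = y ∧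
    g⁻¹ * h ∈ Sbar n
  le_refl x := by
    obtain ⟨g, rfl⟩ := QuotientGroup.mk_surjective x
    exact ⟨g, g, rfl, rfl, by simp [one_mem]⟩
  le_trans := by
    rintro _ _ _ ⟨g, h, rfl, rfl, h1⟩ ⟨h', k, e, rfl, h2⟩
    refine ⟨g, k, rfl, rfl, ?_⟩
    have h3 := mem_Sbar_of_G₁ (QuotientGroup.eq.1 e.symm)
    have := mul_mem (mul_mem h1 h3) h2
    rwa [show g⁻¹ * h * (h⁻¹ * h') * (h'⁻¹ * k) = g⁻¹ * k by group] at this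

attribute [local instance] cosetPreorder

lemma mk_le_mk {g h : Braid n} :
    (g : Braid n ⧸ G₁b n) ≤ (h : Braid n ⧸ G₁b n) ↔ g⁻¹ * h ∈ Sbar n := by
  constructor
  · rintro ⟨g', h', e1, e2, h1⟩
    have h2 := mem_Sbar_of_G₁ (QuotientGroup.eq.1 e1.symm)
    have h3 := mem_Sbar_of_G₁ (QuotientGroup.eq.1 e2)
    have := mul_mem (mul_mem h2 h1) h3
    rwa [show g⁻¹ * g' * (g'⁻¹ * h') * (h'⁻¹ * h) = g⁻¹ * h by group] at this
  · exact fun h1 => ⟨g, h, rfl, rfl, h1⟩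

lemma one_lt_mk (hn : 0 < n) {g : Braid n} (h : g ∈ Spos n) :
    ((1 : Braid n) : Braid n ⧸ G₁b n) < (g : Braid n ⧸ G₁b n) := by
  rw [lt_iff_le_not_ge, mk_le_mk, mk_le_mk, inv_one, one_mul, mul_one]
  exact ⟨Spos_subset_Sbar h, inv_not_mem_Sbar hn h⟩

lemma smul_mk_one (g : Braid n) :
    g • ((1 : Braid n) : Braid n ⧸ G₁b n) = (g : Braid n ⧸ G₁b n) := by
  rw [MulAction.Quotient.smul_coe, smul_eq_mul, mul_one]

lemma orderedAction_coset (hn : 0 < n) :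
    OrderedAction n ((1 : Braid n) : Braid n ⧸ G₁b n) where
  mono g x y := by
    rintro ⟨a, b, rfl, rfl, h⟩
    rw [MulAction.Quotient.smul_coe, MulAction.Quotient.smul_coe, mk_le_mk, smul_eq_mul,
      smul_eq_mul, show (g * a)⁻¹ * (g * b) = a⁻¹ * b by group]
    exact h
  fix i hi := by
    rw [smul_mk_one]
    exact (QuotientGroup.eq.2 (by simpa using gen_mem_G₁b hi)).symm
  lt := by
    rw [smul_mk_one]
    exact one_lt_mk hn gen_zero_mem_Spos

lemma inv_htw_mul_mem_Sbar (hn : 2 ≤ n) {a : Braid n} (ha : a ∈ Mb n) {m : ℕ}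
    (hm : m = 0 → a ∉ G₁b n) (h : a * htw n ^ (-(m : ℤ)) ∈ Sbar n)
    (hD : ∀ i, LDvd a i → i = n - 1) : (htw n)⁻¹ * (a * htw n ^ (-(m : ℤ))) ∈ Sbar n := by
  have := (orderedAction_coset (n := n) (by omega)).htw_smul_le hn ((len a).toNat + 1) ha
    (m := m) (by have := len_nonneg ha; omega) ?_ ?_ hD
  · rwa [← mul_smul, smul_mk_one, smul_mk_one, mk_le_mk] at this
  · rintro rfl
    rw [← mul_smul, smul_mk_one]
    exact one_lt_mk (by omega) ((mem_Spos_or_G₁ h).resolve_right (by simpa using hm rfl))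
  · rwa [← mul_smul, smul_mk_one, mk_le_mk, inv_one, one_mul]

/-- The anti-automorphism fixing the generators, as a homomorphism to the opposite group. -/
def revHom (n : ℕ) : Braid n →* (Braid n)ᵐᵒᵖ :=
  PresentedGroup.toGroup (f := fun i : Fin n => MulOpposite.op (gen n i)) <| by
    have hs := braidSeq_gen n
    rintro r ⟨i, j, ⟨h, rfl⟩ | ⟨h, rfl⟩⟩
    · have := hs.braid i (by omega)
      simp only [map_mul, map_inv, FreeGroup.lift_apply_of, ← h, mul_inv_eq_one]
      simpa only [← MulOpposite.op_mul, MulOpposite.op_inj, mul_assoc] using this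
    · have := hs.comm i j h
      simp only [map_mul, map_inv, FreeGroup.lift_apply_of, mul_inv_eq_one]
      simpa only [← MulOpposite.op_mul, MulOpposite.op_inj] using this.symm

/-- The anti-automorphism reversing words. -/
def rev (g : Braid n) : Braid n := (revHom n g).unop

lemma rev_mul (g h : Braid n) : rev (g * h) = rev h * rev g := by simp [rev]

@[simp] lemma rev_one : rev (1 : Braid n) = 1 := by simp [rev]

lemma rev_inv (g : Braid n) : rev g⁻¹ = (rev g)⁻¹ := by simp [rev]

@[simp] lemma rev_gen (i : ℕ) : rev (gen n i) = gen n i := by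
  by_cases h : i < n
  · have : gen n i = PresentedGroup.of ⟨i, h⟩ := by simp [gen, h]
    rw [rev, revHom]
    conv_lhs => rw [this, PresentedGroup.toGroup.of]
    simp
  · rw [gen_of_le (by omega), rev_one]

lemma rev_rev (g : Braid n) : rev (rev g) = g := by
  have hg : g ∈ Subgroup.closure (Set.range (PresentedGroup.of (rels := braidRel n))) := by
    rw [PresentedGroup.closure_range_of]; trivial
  induction hg using Subgroup.closure_induction with
  | mem x hx =>
    obtain ⟨i, rfl⟩ := hx
    have : gen n i = PresentedGroup.of i := by simp [gen]
    rw [← this, rev_gen, rev_gen]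
  | one => simp
  | mul x y _ _ hx hy => rw [rev_mul, rev_mul, hx, hy]
  | inv x _ hx => rw [rev_inv, rev_inv, hx]

lemma rev_mem_Mb {g : Braid n} (h : g ∈ Mb n) : rev g ∈ Mb n := by
  induction h using Submonoid.closure_induction with
  | mem x hx => obtain ⟨i, hi, rfl⟩ := hx; rw [rev_gen]; exact gen_mem_Mb i
  | one => simp [one_mem]
  | mul x y _ _ hx hy => rw [rev_mul]; exact mul_mem hy hx

lemma rev_mem_G₁b {g : Braid n} (h : g ∈ G₁b n) : rev g ∈ G₁b n := by
  induction h using Subgroup.closure_induction with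
  | mem x hx => obtain ⟨i, hi, _, rfl⟩ := hx; rw [rev_gen]; exact gen_mem_G₁b hi
  | one => simp [one_mem]
  | mul x y _ _ hx hy => rw [rev_mul]; exact mul_mem hy hx
  | inv x _ hx => rw [rev_inv]; exact inv_mem hx

lemma rev_mem_Sbar {g : Braid n} (h : g ∈ Sbar n) : rev g ∈ Sbar n := by
  induction h using Submonoid.closure_induction with
  | mem x hx =>
    rcases hx with hx | rfl
    · exact mem_Sbar_of_G₁ (rev_mem_G₁b hx)
    · rw [rev_gen]; exact gen_zero_mem_Sbar
  | one => simp [one_mem]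
  | mul x y _ _ hx hy => rw [rev_mul]; exact mul_mem hy hx

lemma rev_dn (a k : ℕ) : rev (dn (gen n) a k) = up (gen n) a k := by
  induction k with
  | zero => simp
  | succ k ih => rw [dn_succ, rev_mul, ih, rev_gen, up_succ]

lemma rev_half {k : ℕ} (hk : k ≤ n) : rev (half (gen n) k) = half (gen n) k := by
  induction k with
  | zero => exact rev_one
  | succ k ih =>
    have := ((braidSeq_gen n).mono hk).half_mul_dn (a := 0) (k := k + 1) (by omega)
    rw [show k + 1 - 0 - (k + 1) = 0 by omega, half_succ, ← mul_assoc] at this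
    rw [half_succ, rev_mul, rev_dn, ih (by omega), mul_right_cancel this]

lemma rev_htw : rev (htw n) = htw n := rev_half le_rfl

lemma rev_htw_zpow (m : ℤ) : rev (htw n ^ m) = htw n ^ m := by
  have : rev (htw n ^ m) = rev (htw n) ^ m := by simp [rev]
  rw [this, rev_htw]

/-- The generator `s_i` right-divides `a`. -/
def RDvd (a : Braid n) (i : ℕ) : Prop := i < n ∧ a * (gen n i)⁻¹ ∈ Mb n

lemma mul_inv_htw_mem_Sbar (hn : 2 ≤ n) {a : Braid n} (ha : a ∈ Mb n) {m : ℕ}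
    (hm : m = 0 → a ∉ G₁b n) (h : htw n ^ (-(m : ℤ)) * a ∈ Sbar n)
    (hD : ∀ i, RDvd a i → i = n - 1) : htw n ^ (-(m : ℤ)) * a * (htw n)⁻¹ ∈ Sbar n := by
  have := rev_mem_Sbar <| inv_htw_mul_mem_Sbar hn (rev_mem_Mb ha) (m := m)
    (fun h0 h1 => hm h0 (by simpa only [rev_rev] using rev_mem_G₁b h1))
    (by simpa only [rev_mul, rev_htw_zpow] using rev_mem_Sbar h)
    (fun i hi => hD i ⟨hi.1, by
      simpa only [rev_mul, rev_rev, rev_inv, rev_gen] using rev_mem_Mb hi.2⟩)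
  simpa only [rev_mul, rev_htw_zpow, rev_rev, rev_inv, rev_htw] using this

end BraidOrder

namespace BraidOrder

variable {n : ℕ}

lemma eq_one_of_inv_mem_Mb {x : Braid n} (h : x ∈ Mb n) (h' : x⁻¹ ∈ Mb n) : x = 1 := by
  by_contra h1
  obtain ⟨i, hi, hx⟩ := exists_LDvd h h1
  have h2 := len_nonneg hx
  have h3 := len_nonneg h'
  rw [len_mul, len_inv, len_gen hi] at h2
  rw [len_inv] at h3
  omega

lemma exists_RDvd {a : Braid n} (h : a ∈ Mb n) (h1 : a ≠ 1) : ∃ i, RDvd a i := by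
  obtain ⟨i, hi, hx⟩ := exists_LDvd (rev_mem_Mb h)
    (fun h2 => h1 (by rw [← rev_rev a, h2, rev_one]))
  exact ⟨i, hi, by simpa only [rev_mul, rev_inv, rev_rev, rev_gen] using rev_mem_Mb hx⟩

/-- The submonoid generated by the generators whose index satisfies `K`. -/
def gensub (n : ℕ) (K : ℕ → Prop) : Submonoid (Braid n) :=
  Submonoid.closure {x | ∃ i, K i ∧ i < n ∧ x = gen n i}

variable {K : ℕ → Prop}

lemma gen_mem_gensub {i : ℕ} (hK : K i) (hi : i < n) : gen n i ∈ gensub n K :=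
  Submonoid.subset_closure ⟨i, hK, hi, rfl⟩

lemma gensub_le_Mb : gensub n K ≤ Mb n :=
  Submonoid.closure_mono fun _ ⟨i, _, hi, h⟩ => ⟨i, hi, h⟩

lemma gensub_cases {c : Braid n} (h : c ∈ gensub n K) :
    c = 1 ∨ ∃ c' ∈ gensub n K, ∃ j, K j ∧ j < n ∧ c = c' * gen n j := by
  induction h using Submonoid.closure_induction_right with
  | one => exact Or.inl rfl
  | mul_right x hx y hy _ =>
    obtain ⟨j, hj, hjn, rfl⟩ := hy
    exact Or.inr ⟨x, hx, j, hj, hjn, rfl⟩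

/-- `b` is the greatest right divisor of `a` in `gensub n K`. -/
structure IsTail (K : ℕ → Prop) (a b : Braid n) : Prop where
  mem : b ∈ gensub n K
  dvd : a * b⁻¹ ∈ Mb n
  greatest : ∀ c ∈ gensub n K, a * c⁻¹ ∈ Mb n → b * c⁻¹ ∈ Mb n

lemma IsTail.unique {a b c : Braid n} (hb : IsTail K a b) (hc : IsTail K a c) : b = c := by
  have h1 := hb.greatest c hc.mem hc.dvd
  have h2 := hc.greatest b hb.mem hb.dvd
  exact mul_inv_eq_one.1 (eq_one_of_inv_mem_Mb h1 (by simpa using h2))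

lemma exists_isTail_and_mul_gen (K : ℕ → Prop) (L : ℕ) {a : Braid n} (ha : a ∈ Mb n)
    (hL : len a < L) : (∃ b, IsTail K a b) ∧
      ∀ i b, K i → RDvd a i → IsTail K (a * (gen n i)⁻¹) b → IsTail K a (b * gen n i) := by
  induction L generalizing a with
  | zero => have := len_nonneg ha; omega
  | succ L ih =>
    have hlen : ∀ {i}, i < n → len (a * (gen n i)⁻¹) < L := fun hi => by
      rw [len_mul, len_inv, len_gen hi]; omega
    have hmul : ∀ {w i b}, w ∈ Mb n → i < n → len (w * gen n i) < L → K i → IsTail K w b →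
        IsTail K (w * gen n i) (b * gen n i) := fun {w i b} hw hi hl hK hb =>
      (ih (mul_mem hw (gen_mem_Mb i)) hl).2 i b hK ⟨hi, by simpa using hw⟩ (by simpa using hb)
    have hstep : ∀ i b, K i → RDvd a i → IsTail K (a * (gen n i)⁻¹) b →
        IsTail K a (b * gen n i) := by
      intro i b hK hi hb
      refine ⟨mul_mem hb.mem (gen_mem_gensub hK hi.1), ?_, fun c hc hac => ?_⟩
      · rw [mul_inv_rev, ← mul_assoc]; exact hb.dvd
      rcases gensub_cases hc with rfl | ⟨c, hc', j, hKj, hj, rfl⟩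
      · simpa using mul_mem (gensub_le_Mb hb.mem) (gen_mem_Mb i)
      rw [mul_inv_rev, ← mul_assoc] at hac
      have hj' : a * (gen n j)⁻¹ ∈ Mb n := by
        simpa using mul_mem hac (gensub_le_Mb hc')
      obtain ⟨b', hb'⟩ := (ih hj' (hlen hj)).1
      suffices b * gen n i = b' * gen n j by
        rw [this, mul_inv_rev, ← mul_assoc, mul_inv_cancel_right]
        exact hb'.greatest c hc' hac
      have hli := hlen hi.1
      have hlj := hlen hj
      rcases lcm_dvd hi.2 hj' hi.1 hj (by simp) with
        ⟨rfl, -⟩ | ⟨-, w, hw, hu, hv⟩ | ⟨-, w, hw, hu, hv⟩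
      · rw [hb.unique hb']
      · rw [hu] at hb hli
        rw [hv] at hb' hlj
        have hlw : len w < L := by
          rw [len_mul, len_gen hj] at hli; omega
        obtain ⟨d, hd⟩ := (ih hw hlw).1
        have e : gen n j * gen n i = gen n i * gen n j := by
          have h1 : w * gen n j * gen n i = a := by rw [← hu]; simp
          have h2 : w * gen n i * gen n j = a := by rw [← hv]; simp
          rw [mul_assoc] at h1 h2
          exact mul_left_cancel (h1.trans h2.symm)
        rw [hb.unique (hmul hw hj hli hKj hd), hb'.unique (hmul hw hi.1 hlj hK hd), mul_assoc, e,
          mul_assoc]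
      · rw [hu] at hb hli
        rw [hv] at hb' hlj
        have hlw : len (w * gen n i) < L := by
          rw [len_mul, len_gen hj] at hli; omega
        have hlw' : len (w * gen n j) < L := by
          rw [len_mul, len_gen hi.1] at hlj; omega
        have hlw0 : len w < L := by
          rw [len_mul, len_gen hi.1] at hlw; omega
        obtain ⟨d, hd⟩ := (ih hw hlw0).1
        have e : gen n i * gen n j * gen n i = gen n j * gen n i * gen n j := by
          have h1 : w * gen n i * gen n j * gen n i = a := by rw [← hu]; simp
          have h2 : w * gen n j * gen n i * gen n j = a := by rw [← hv]; simp
          simp only [mul_assoc] at h1 h2 ⊢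
          exact mul_left_cancel (h1.trans h2.symm)
        rw [hb.unique (hmul (mul_mem hw (gen_mem_Mb i)) hj hli hKj (hmul hw hi.1 hlw hK hd)),
          hb'.unique (hmul (mul_mem hw (gen_mem_Mb j)) hi.1 hlj hK (hmul hw hj hlw' hKj hd))]
        simp only [mul_assoc] at e ⊢
        rw [e]
    refine ⟨?_, hstep⟩
    by_cases h : ∃ i, K i ∧ RDvd a i
    · obtain ⟨i, hK, hi⟩ := h
      obtain ⟨b, hb⟩ := (ih hi.2 (hlen hi.1)).1
      exact ⟨_, hstep i b hK hi hb⟩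
    · refine ⟨1, one_mem _, by simpa using ha, fun c hc hac => ?_⟩
      rcases gensub_cases hc with rfl | ⟨c, hc', j, hKj, hj, rfl⟩
      · simp [one_mem]
      · refine absurd ⟨j, hKj, hj, ?_⟩ h
        rw [mul_inv_rev, ← mul_assoc] at hac
        simpa using mul_mem hac (gensub_le_Mb hc')

lemma isTail_tail (K : ℕ → Prop) {a : Braid n} (ha : a ∈ Mb n) :
    IsTail K a (GarsideOrder.tail (Mb n) (gensub n K) a) := by
  obtain ⟨b, hb⟩ := (exists_isTail_and_mul_gen K ((len a).toNat + 1) ha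
    (by have := len_nonneg ha; omega)).1
  have h : ∃ b : Braid n, b ∈ gensub n K ∧
      {c : Braid n | c ∈ gensub n K ∧ GarsideOrder.leR (Mb n) c a} =
        {c : Braid n | c ∈ gensub n K ∧ GarsideOrder.leR (Mb n) c b} := by
    refine ⟨b, hb.mem, Set.ext fun c => and_congr_right fun hc => ⟨hb.greatest c hc, fun h => ?_⟩⟩
    have := mul_mem hb.dvd h
    rwa [mul_assoc, inv_mul_cancel_left] at this
  rw [GarsideOrder.tail, dif_pos h]
  obtain ⟨h1, h2⟩ := h.choose_spec
  refine ⟨h1, ?_, fun c hc hac => ?_⟩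
  · exact ((Set.ext_iff.1 h2 _).2 ⟨h1, by simp [GarsideOrder.leR, one_mem]⟩).2
  · exact ((Set.ext_iff.1 h2 c).1 ⟨hc, hac⟩).2

lemma IsTail.not_RDvd {a b : Braid n} (hb : IsTail K a b) {i : ℕ} (h : RDvd (a * b⁻¹) i) :
    ¬ K i := fun hK => by
  have h1 := hb.greatest (gen n i * b) (mul_mem (gen_mem_gensub hK h.1) hb.mem)
    (by rw [mul_inv_rev, ← mul_assoc]; exact h.2)
  have h2 := len_nonneg h1
  rw [mul_inv_rev, mul_inv_cancel_left, len_inv, len_gen h.1] at h2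
  omega

lemma M₁b_eq : M₁b n = gensub n (1 ≤ ·) := rfl

lemma Nb_eq : Nb n = gensub n (· + 1 < n) := by
  rw [Nb, gensub]
  congr 1
  ext x
  exact ⟨fun ⟨i, h, e⟩ => ⟨i, h, by omega, e⟩, fun ⟨i, h, _, e⟩ => ⟨i, h, e⟩⟩

/-- The `i`-th remainder of the alternating decomposition. -/
noncomputable def remd (a : Braid n) (i : ℕ) : Braid n :=
  GarsideOrder.strip (Mb n) (M₁b n) (Nb n) i a

/-- The generators of `M₁` (even `i`) or `N` (odd `i`). -/
def altIdx (n i : ℕ) (j : ℕ) : Prop := if i % 2 = 0 then 1 ≤ j else j + 1 < n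

lemma altIdx_even (i : ℕ) : altIdx n (2 * i) = (1 ≤ ·) := by
  funext j
  simp [altIdx]

lemma altIdx_odd (i : ℕ) : altIdx n (2 * i + 1) = (· + 1 < n) := by
  funext j
  simp [altIdx, Nat.add_mod]

/-- The `i`-th factor of the alternating decomposition. -/
noncomputable def factor (a : Braid n) (i : ℕ) : Braid n :=
  GarsideOrder.tail (Mb n) (gensub n (altIdx n i)) (remd a i)

lemma remd_zero (a : Braid n) : remd a 0 = a := rfl

lemma remd_succ (a : Braid n) (i : ℕ) : remd a (i + 1) = remd a i * (factor a i)⁻¹ := by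
  have : (if i % 2 = 0 then M₁b n else Nb n) = gensub n (altIdx n i) := by
    obtain ⟨k, rfl | rfl⟩ := i.even_or_odd'
    · rw [altIdx_even, if_pos (by omega), M₁b_eq]
    · rw [altIdx_odd, if_neg (by omega), Nb_eq]
  rw [remd, GarsideOrder.strip, this]
  rfl

lemma remd_mem_Mb {a : Braid n} (ha : a ∈ Mb n) : ∀ i, remd a i ∈ Mb n
  | 0 => ha
  | i + 1 => by
    rw [remd_succ]
    exact (isTail_tail _ (remd_mem_Mb ha i)).dvd

lemma isTail_factor {a : Braid n} (ha : a ∈ Mb n) (i : ℕ) :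
    IsTail (altIdx n i) (remd a i) (factor a i) := isTail_tail _ (remd_mem_Mb ha i)

lemma remd_eq_mul (a : Braid n) (i : ℕ) : remd a i = remd a (i + 1) * factor a i := by
  rw [remd_succ, inv_mul_cancel_right]

lemma factor_even_mem {a : Braid n} (ha : a ∈ Mb n) (i : ℕ) : factor a (2 * i) ∈ M₁b n := by
  have := (isTail_factor ha (2 * i)).mem
  rwa [altIdx_even] at this

lemma factor_odd_mem {a : Braid n} (ha : a ∈ Mb n) (i : ℕ) : factor a (2 * i + 1) ∈ Nb n := by
  have := (isTail_factor ha (2 * i + 1)).mem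
  rwa [altIdx_odd, ← Nb_eq] at this

lemma RDvd_remd_odd {a : Braid n} (ha : a ∈ Mb n) {i j : ℕ} (h : RDvd (remd a (2 * i + 1)) j) :
    j = 0 := by
  rw [remd_succ] at h
  have := (isTail_factor ha (2 * i)).not_RDvd h
  rw [altIdx_even] at this
  omega

lemma RDvd_remd_even {a : Braid n} (ha : a ∈ Mb n) {i j : ℕ}
    (h : RDvd (remd a (2 * i + 2)) j) : j = n - 1 := by
  rw [show 2 * i + 2 = 2 * i + 1 + 1 by ring, remd_succ] at h
  have h1 := h.1
  have := (isTail_factor ha (2 * i + 1)).not_RDvd h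
  rw [altIdx_odd] at this
  omega

lemma len_factor_nonneg {a : Braid n} (ha : a ∈ Mb n) (i : ℕ) : 0 ≤ len (factor a i) :=
  len_nonneg (gensub_le_Mb (isTail_factor ha i).mem)

lemma len_remd {a : Braid n} (i : ℕ) : len (remd a i) = len (remd a (i + 1)) + len (factor a i) := by
  rw [remd_eq_mul, len_mul]

lemma remd_succ_eq_one {a : Braid n} (ha : a ∈ Mb n) {i : ℕ} (h : remd a i = 1) :
    remd a (i + 1) = 1 := by
  have h1 := remd_mem_Mb ha (i + 1)
  refine eq_one_of_inv_mem_Mb h1 ?_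
  rw [remd_succ, h, one_mul, inv_inv]
  exact gensub_le_Mb (isTail_factor ha i).mem

lemma remd_eq_one_of_le {a : Braid n} (ha : a ∈ Mb n) {i j : ℕ} (h : remd a i = 1) (hij : i ≤ j) :
    remd a j = 1 := by
  induction j, hij using Nat.le_induction with
  | base => exact h
  | succ j _ ih => exact remd_succ_eq_one ha ih

lemma len_remd_add_two_lt (hn : 2 ≤ n) {a : Braid n} (ha : a ∈ Mb n) {i : ℕ} (h : remd a (2 * i) ≠ 1) :
    len (remd a (2 * i + 2)) < len (remd a (2 * i)) := by
  by_contra hlt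
  have h1 := len_remd (a := a) (2 * i)
  have h2 := len_remd (a := a) (2 * i + 1)
  have h3 := len_factor_nonneg ha (2 * i)
  have h4 := len_factor_nonneg ha (2 * i + 1)
  have key : ∀ i, len (factor a i) = 0 → remd a (i + 1) = remd a i := by
    intro i h0
    rw [remd_succ]
    have : factor a i = 1 := by
      by_contra h1
      obtain ⟨j, hj, hx⟩ := exists_RDvd (gensub_le_Mb (isTail_factor ha i).mem) h1
      have := len_nonneg hx
      rw [len_mul, len_inv, len_gen hj] at this
      omega
    rw [this, inv_one, mul_one]
  have e1 := key (2 * i) (by rw [show 2 * i + 2 = 2 * i + 1 + 1 by ring] at hlt; omega)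
  have e2 := key (2 * i + 1) (by rw [show 2 * i + 2 = 2 * i + 1 + 1 by ring] at hlt; omega)
  obtain ⟨j, hj⟩ := exists_RDvd (remd_mem_Mb ha (2 * i)) h
  have := RDvd_remd_odd ha (e1 ▸ hj)
  have := RDvd_remd_even ha (i := i) (j := j) (by
    rw [show 2 * i + 2 = 2 * i + 1 + 1 by ring, e2, e1]; exact hj)
  omega

lemma exists_remd_eq_one (hn : 2 ≤ n) {a : Braid n} (ha : a ∈ Mb n) : ∃ i, remd a i = 1 := by
  by_contra! h
  have : ∀ i : ℕ, len (remd a (2 * i)) ≤ len a - i := by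
    intro i
    induction i with
    | zero => simp [remd_zero]
    | succ i ih =>
      have := len_remd_add_two_lt hn ha (h (2 * i))
      rw [show 2 * (i + 1) = 2 * i + 2 by ring]
      push_cast
      omega
  have h1 := this ((len a).toNat + 1)
  have h2 := len_nonneg (remd_mem_Mb ha (2 * ((len a).toNat + 1)))
  have h3 := len_nonneg ha
  omega

lemma dpt_le_iff (hn : 2 ≤ n) {a : Braid n} (ha : a ∈ Mb n) {k : ℕ} :
    GarsideOrder.dpt (Mb n) (M₁b n) (Nb n) a ≤ k ↔ remd a (2 * k + 1) = 1 := by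
  have hne : {p : ℕ | 1 ≤ p ∧ remd a p = 1}.Nonempty := by
    obtain ⟨i, hi⟩ := exists_remd_eq_one hn ha
    exact ⟨i + 1, by omega, remd_succ_eq_one ha hi⟩
  have hd : GarsideOrder.dpt (Mb n) (M₁b n) (Nb n) a = sInf {p : ℕ | 1 ≤ p ∧ remd a p = 1} / 2 :=
    rfl
  have hs := Nat.sInf_mem hne
  rw [hd]
  constructor
  · intro h
    exact remd_eq_one_of_le ha hs.2 (by omega)
  · intro h
    have := Nat.sInf_le (s := {p : ℕ | 1 ≤ p ∧ remd a p = 1}) ⟨by omega, h⟩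
    omega

end BraidOrder

namespace BraidOrder

open GarsideOrder

variable {n : ℕ}

lemma seg_zero_eq_up (k : ℕ) : seg n 0 k = up (gen n) 0 k := by
  induction k with
  | zero => rfl
  | succ k ih =>
    rw [seg, List.drop_zero] at ih ⊢
    rw [List.prod_range_succ, ih, up_succ, zero_add]

lemma Δb_eq_fullTwist : Δb n = up (gen n) 0 n ^ (n + 1) := by rw [Δb, seg_zero_eq_up]

lemma Δb_eq_htw_mul : Δb n = htw n * htw n := by
  rw [Δb_eq_fullTwist, htw, (braidSeq_gen n).half_sq]

lemma commute_Δb (g : Braid n) : Commute (Δb n) g := by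
  have := flip_flip g
  rw [flip_apply, flip_apply] at this
  rw [Commute, SemiconjBy, Δb_eq_htw_mul]
  calc htw n * htw n * g
      = htw n * (htw n * g * (htw n)⁻¹) * (htw n)⁻¹ * (htw n * htw n) := by group
    _ = g * (htw n * htw n) := by rw [this]

lemma htw_zpow_neg_two_mul (l : ℕ) : htw n ^ (-((2 * l : ℕ) : ℤ)) = (Δb n ^ l)⁻¹ := by
  rw [zpow_neg, zpow_natCast, pow_mul, Δb_eq_htw_mul, sq]

lemma htw_zpow_neg_two_mul_add_one (l : ℕ) :
    htw n ^ (-((2 * l + 1 : ℕ) : ℤ)) = (htw n)⁻¹ * (Δb n ^ l)⁻¹ := by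
  rw [zpow_neg, zpow_natCast, pow_succ, pow_mul, Δb_eq_htw_mul, sq, mul_inv_rev]

lemma Δb_mem_Mb : Δb n ∈ Mb n := by
  rw [Δb_eq_htw_mul]
  exact mul_mem htw_mem_Mb htw_mem_Mb

lemma htw_mem_Spos (hn : 0 < n) : htw n ∈ Spos n := by
  obtain ⟨k, rfl⟩ : ∃ k, n = k + 1 := ⟨n - 1, by omega⟩
  rw [htw, half_succ, dn_succ', ← mul_assoc]
  exact ⟨_, Mb_le_Sbar (mul_mem (half_mem fun i _ => gen_mem_Mb i) (dn_mem_Mb _ _)), 1,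
    one_mem _, (mul_one _).symm⟩

lemma M₁b_subset_G₁b {g : Braid n} (h : g ∈ M₁b n) : g ∈ G₁b n :=
  (Submonoid.closure_le (S := (G₁b n).toSubmonoid)).2 Subgroup.subset_closure h

lemma flip_mem_G₁b {g : Braid n} (h : g ∈ Nb n) : flip n g ∈ G₁b n := by
  induction h using Submonoid.closure_induction with
  | mem x hx =>
    obtain ⟨i, hi, rfl⟩ := hx
    rw [flip_gen (by omega)]
    exact gen_mem_G₁b (by omega)
  | one => simp [one_mem]
  | mul x y _ _ hx hy => rw [map_mul]; exact mul_mem hx hy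

lemma inv_htw_mul_flip (g : Braid n) : (htw n)⁻¹ * flip n g = g * (htw n)⁻¹ := by
  rw [flip_apply]; group

lemma inv_mul_Δb_mem_Spos (hn : 0 < n) {g : Braid n} (h : g ∈ Nb n) :
    g⁻¹ * Δb n ∈ Spos n := by
  have : g⁻¹ * Δb n = htw n * ((flip n g)⁻¹ * htw n) := by
    have := flip_flip g
    rw [flip_apply (flip n g)] at this
    rw [Δb_eq_htw_mul]
    conv_lhs => rw [← this]
    group
  rw [this]
  have h1 := htw_mem_Spos hn
  exact Spos_mul_Sbar h1 (mul_mem (mem_Sbar_of_G₁ (inv_mem (flip_mem_G₁b h))) (Spos_subset_Sbar h1))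

lemma inv_remd_mul_Δb_pow_mem (hn : 0 < n) {a : Braid n} (ha : a ∈ Mb n) {k : ℕ}
    (h : remd a (2 * k + 1) = 1) {j : ℕ} (hj : j ≤ k) :
    (remd a (2 * (k - j)))⁻¹ * Δb n ^ j ∈ Sbar n ∧
      (1 ≤ j → (remd a (2 * (k - j)))⁻¹ * Δb n ^ j ∈ Spos n) := by
  induction j with
  | zero =>
    refine ⟨?_, fun h => absurd h (by omega)⟩
    rw [Nat.sub_zero, remd_eq_mul, h, one_mul, pow_zero, mul_one]
    exact mem_Sbar_of_G₁ (inv_mem (M₁b_subset_G₁b (factor_even_mem ha k)))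
  | succ j ih =>
    suffices h : (remd a (2 * (k - (j + 1))))⁻¹ * Δb n ^ (j + 1) ∈ Spos n from
      ⟨Spos_subset_Sbar h, fun _ => h⟩
    obtain ⟨i, rfl⟩ : ∃ i, k = i + (j + 1) := ⟨k - (j + 1), by omega⟩
    have h1 := (ih (by omega)).1
    rw [show i + (j + 1) - j = i + 1 by omega] at h1
    rw [show i + (j + 1) - (j + 1) = i by omega]
    have h2 := inv_mul_Δb_mem_Spos hn (factor_odd_mem ha i)
    have h3 := mem_Sbar_of_G₁ (inv_mem (M₁b_subset_G₁b (factor_even_mem ha i)))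
    have := Sbar_mul_Spos h3 (Spos_mul_Sbar h2 h1)
    rw [remd_eq_mul, remd_eq_mul a (2 * i + 1), mul_inv_rev, mul_inv_rev]
    rw [mul_assoc (factor a (2 * i + 1))⁻¹, ← mul_assoc (Δb n), (commute_Δb _).eq, mul_assoc,
      ← pow_succ'] at this
    simpa only [mul_assoc, show 2 * i + 1 + 1 = 2 * (i + 1) by ring] using this

/-- If the depth of `a` is at most `k`, then `a Δ^{-k}` is the inverse of an element of `Spos`. -/
lemma inv_mul_Δb_pow_mem_Spos (hn : 0 < n) {a : Braid n} (ha : a ∈ Mb n) {k : ℕ} (hk : 1 ≤ k)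
    (h : remd a (2 * k + 1) = 1) : (a * (Δb n ^ k)⁻¹)⁻¹ ∈ Spos n := by
  have := (inv_remd_mul_Δb_pow_mem hn ha h le_rfl).2 hk
  rw [Nat.sub_self, mul_zero, remd_zero] at this
  rwa [mul_inv_rev, inv_inv, ((commute_Δb _).pow_left k).eq]

lemma mul_inv_htw_of_even (hn : 2 ≤ n) {a : Braid n} (ha : a ∈ Mb n) {l : ℕ}
    (hl : l = 0 → a ∉ G₁b n) (h : a * (Δb n ^ l)⁻¹ ∈ Sbar n)
    (hD : ∀ i, RDvd a i → i = n - 1) : a * (Δb n ^ l)⁻¹ * (htw n)⁻¹ ∈ Sbar n := by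
  have hc := ((commute_Δb a).pow_left l).inv_left.eq
  have := mul_inv_htw_mem_Sbar hn ha (m := 2 * l) (fun h => hl (by omega))
    (by rwa [htw_zpow_neg_two_mul, hc]) hD
  rwa [htw_zpow_neg_two_mul, hc] at this

lemma mul_inv_htw_of_odd (hn : 2 ≤ n) {a : Braid n} (ha : a ∈ Mb n) {l : ℕ}
    (h : a * (Δb n ^ l)⁻¹ * (htw n)⁻¹ ∈ Sbar n)
    (hD : ∀ i, RDvd a i → i = 0) : a * (Δb n ^ (l + 1))⁻¹ ∈ Sbar n := by
  have hc := fun g : Braid n => ((commute_Δb g).pow_left l).inv_left.eq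
  have e : htw n ^ (-((2 * l + 1 : ℕ) : ℤ)) * flip n a = a * (Δb n ^ l)⁻¹ * (htw n)⁻¹ := by
    rw [htw_zpow_neg_two_mul_add_one, mul_assoc, hc, ← mul_assoc, inv_htw_mul_flip, mul_assoc,
      ← hc, mul_assoc]
  have := mul_inv_htw_mem_Sbar hn (flip_mem_Mb ha) (m := 2 * l + 1) (fun h => by omega)
    (by rwa [e]) fun i hi => ?_
  · rw [e] at this
    rwa [pow_succ, mul_inv_rev, Δb_eq_htw_mul, mul_inv_rev, ← Δb_eq_htw_mul, ← hc, ← mul_assoc,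
      ← mul_assoc]
  · have h1 := hi.1
    have h2 := flip_mem_Mb hi.2
    rw [map_mul, flip_flip, map_inv, flip_gen h1] at h2
    have := hD _ ⟨by omega, h2⟩
    omega

lemma remd_mul_inv_mem_Sbar (hn : 2 ≤ n) {a : Braid n} (ha : a ∈ Mb n) {k : ℕ}
    (h : remd a (2 * k + 1) ≠ 1) {l : ℕ} (hl : l ≤ k) :
    remd a (2 * (k - l) + 1) * (Δb n ^ l)⁻¹ ∈ Sbar n := by
  have hc := fun (l : ℕ) (g : Braid n) => ((commute_Δb g).pow_left l).inv_left.eq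
  induction l with
  | zero => simpa using Mb_le_Sbar (remd_mem_Mb ha _)
  | succ l ih =>
    obtain ⟨i, rfl⟩ : ∃ i, k = i + (l + 1) := ⟨k - (l + 1), by omega⟩
    have h1 := ih (by omega)
    rw [show i + (l + 1) - l = i + 1 by omega] at h1
    rw [show i + (l + 1) - (l + 1) = i by omega]
    have h2 : remd a (2 * i + 2) * (Δb n ^ l)⁻¹ ∈ Sbar n := by
      have := mul_mem h1 (mem_Sbar_of_G₁ (M₁b_subset_G₁b (factor_even_mem ha (i + 1))))
      rwa [mul_assoc, hc, ← mul_assoc, ← remd_eq_mul] at this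
    have h3 := mul_inv_htw_of_even hn (remd_mem_Mb ha _) (fun h0 => ?_) h2
      fun j hj => RDvd_remd_even ha hj
    · refine mul_inv_htw_of_odd hn (remd_mem_Mb ha _) ?_ fun j hj => RDvd_remd_odd ha hj
      have := mul_mem h3 (mem_Sbar_of_G₁ (flip_mem_G₁b (factor_odd_mem ha i)))
      rwa [mul_assoc, inv_htw_mul_flip, mul_assoc, ← mul_assoc (_⁻¹), hc, mul_assoc, ← mul_assoc,
        ← remd_eq_mul, ← mul_assoc] at this
    · subst h0
      rw [show 2 * i + 2 = 2 * (i + 1) by ring, remd_eq_mul]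
      obtain ⟨j, hj⟩ := exists_RDvd (remd_mem_Mb ha _) h
      obtain rfl := RDvd_remd_odd ha hj
      refine not_mem_G₁_of_mem_Spos (by omega) ?_
      refine Spos_mul_Sbar ⟨_, Mb_le_Sbar hj.2, 1, one_mem _, ?_⟩
        (Mb_le_Sbar (gensub_le_Mb (isTail_factor ha _).mem))
      simp

/-- If the depth of `a` exceeds `k`, then `a Δ^{-k}` lies in `Sbar`. -/
lemma mul_inv_Δb_pow_mem_Sbar (hn : 2 ≤ n) {a : Braid n} (ha : a ∈ Mb n) {k : ℕ}
    (h : remd a (2 * k + 1) ≠ 1) : a * (Δb n ^ k)⁻¹ ∈ Sbar n := by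
  have h1 := remd_mul_inv_mem_Sbar hn ha h le_rfl
  rw [Nat.sub_self, mul_zero] at h1
  have := mul_mem h1 (mem_Sbar_of_G₁ (M₁b_subset_G₁b (factor_even_mem ha 0)))
  rwa [mul_assoc, ((commute_Δb _).pow_left k).inv_left.eq, ← mul_assoc, mul_zero, ← remd_eq_mul,
    remd_zero] at this

lemma exists_mul_Δb_pow_mem_Mb (g : Braid n) : ∃ k : ℕ, g * Δb n ^ k ∈ Mb n := by
  suffices (∃ k : ℕ, g * Δb n ^ k ∈ Mb n) ∧ ∃ k : ℕ, g⁻¹ * Δb n ^ k ∈ Mb n from this.1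
  have hmul : ∀ {x y : Braid n}, (∃ k : ℕ, x * Δb n ^ k ∈ Mb n) → (∃ k : ℕ, y * Δb n ^ k ∈ Mb n) →
      ∃ k : ℕ, x * y * Δb n ^ k ∈ Mb n := by
    rintro x y ⟨k, hk⟩ ⟨l, hl⟩
    refine ⟨k + l, ?_⟩
    have := mul_mem hk hl
    rwa [mul_assoc, ← mul_assoc _ y, ((commute_Δb y).pow_left k).eq, mul_assoc, ← pow_add,
      ← mul_assoc] at this
  have hg : g ∈ Subgroup.closure (Set.range (PresentedGroup.of (rels := braidRel n))) := by
    rw [PresentedGroup.closure_range_of]; trivial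
  induction hg using Subgroup.closure_induction with
  | mem x hx =>
    obtain ⟨i, rfl⟩ := hx
    have : gen n i = PresentedGroup.of i := by simp [gen]
    rw [← this]
    refine ⟨⟨0, by simpa using gen_mem_Mb i⟩, 1, ?_⟩
    obtain ⟨r, hr, e⟩ := (braidSeq_gen n).exists_mul_eq_fullTwist i.2
    rw [← Δb_eq_fullTwist] at e
    rw [pow_one, ← (commute_Δb _).eq, ← e, mul_inv_cancel_right]
    exact hr
  | one => exact ⟨⟨0, by simp [one_mem]⟩, 0, by simp [one_mem]⟩
  | mul x y _ _ hx hy =>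
    rw [mul_inv_rev]
    exact ⟨hmul hx.1 hy.1, hmul hy.2 hx.2⟩
  | inv x _ hx => exact ⟨hx.2, by simpa using hx.1⟩

lemma one_not_mem_Spos (hn : 0 < n) : (1 : Braid n) ∉ Spos n := fun h =>
  not_mem_G₁_of_mem_Spos hn h (one_mem _)

lemma Δb_mem_Spos (hn : 0 < n) : Δb n ∈ Spos n := by
  rw [Δb_eq_htw_mul]
  exact Spos_mul_Sbar (htw_mem_Spos hn) (Spos_subset_Sbar (htw_mem_Spos hn))

lemma dpt_Δb_pow (hn : 2 ≤ n) {k : ℕ} (hk : 1 ≤ k) :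
    dpt (Mb n) (M₁b n) (Nb n) (Δb n ^ k) = k + 1 := by
  have hM : Δb n ^ k ∈ Mb n := pow_mem Δb_mem_Mb k
  refine le_antisymm ((dpt_le_iff hn hM).2 ?_) (Nat.lt_of_not_le fun h => ?_)
  · by_contra h
    have := mul_inv_Δb_pow_mem_Sbar hn hM h
    rw [pow_succ', mul_inv_rev, mul_inv_cancel_left] at this
    exact inv_not_mem_Sbar (by omega) (Δb_mem_Spos (by omega)) this
  · have := inv_mul_Δb_pow_mem_Spos (by omega) hM hk ((dpt_le_iff hn hM).1 h)
    rw [mul_inv_cancel, inv_one] at this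
    exact one_not_mem_Spos (by omega) this

/-- The negative elements are the inverses of the elements of `Spos`. -/
lemma negative_iff (hn : 2 ≤ n) {α : Braid n} :
    Negative (Mb n) (M₁b n) (Nb n) (Δb n) α ↔ α⁻¹ ∈ Spos n := by
  have hn0 : 0 < n := by omega
  constructor
  · rintro ⟨a, k, ha, hk, rfl, h⟩
    rw [dpt_Δb_pow hn hk] at h
    exact inv_mul_Δb_pow_mem_Spos hn0 ha.1 hk ((dpt_le_iff hn ha.1).1 (by omega))
  · intro h
    have hα : α ∉ Sbar n := by simpa using inv_not_mem_Sbar hn0 h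
    classical
    have hex := exists_mul_Δb_pow_mem_Mb α
    obtain ⟨k, hk⟩ : ∃ k, Nat.find hex = k + 1 := Nat.exists_eq_succ_of_ne_zero fun h0 => by
      have := Nat.find_spec hex
      rw [h0, pow_zero, mul_one] at this
      exact hα (Mb_le_Sbar this)
    have ha := Nat.find_spec hex
    have hmin := Nat.find_min hex (m := k) (by omega)
    rw [hk] at ha
    refine ⟨α * Δb n ^ (k + 1), k + 1, ⟨ha, fun h1 => hmin ?_⟩, by omega, by simp, ?_⟩
    · rwa [leR, pow_succ, mul_assoc, mul_inv_cancel_right] at h1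
    · rw [dpt_Δb_pow hn (by omega), Nat.lt_succ_iff, dpt_le_iff hn ha]
      by_contra h1
      have := mul_inv_Δb_pow_mem_Sbar hn ha h1
      rw [mul_inv_cancel_right] at this
      exact hα this

lemma mem_Spos_or (hn : 2 ≤ n) (α : Braid n) : α ∈ Spos n ∨ α⁻¹ ∈ Spos n ∨ α ∈ G₁b n := by
  obtain ⟨k, hk⟩ := exists_mul_Δb_pow_mem_Mb α
  have ha := mul_mem hk (Δb_mem_Mb (n := n))
  rw [mul_assoc, ← pow_succ] at ha
  by_cases h : remd (α * Δb n ^ (k + 1)) (2 * (k + 1) + 1) = 1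
  · have := inv_mul_Δb_pow_mem_Spos (by omega) ha (by omega) h
    rw [mul_inv_cancel_right] at this
    exact Or.inr (Or.inl this)
  · have := mul_inv_Δb_pow_mem_Sbar hn ha h
    rw [mul_inv_cancel_right] at this
    exact (mem_Spos_or_G₁ this).imp_right Or.inr

end BraidOrder

open GarsideOrder BraidOrder in
/-- In the braid group `B_{n+1}`, the pair `(H, G₁)` is a Dehornoy structure:
`PP ⊆ P`, `G₁ P G₁ ⊆ P`, and `G` is the disjoint union of `P`, `P⁻¹` and `G₁`. -/
theorem statement10 (n : ℕ) (hn : 2 ≤ n)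
    (Pneg : Set (Braid n)) (hPneg : Pneg = {α | Negative (Mb n) (M₁b n) (Nb n) (Δb n) α})
    (Ppos : Set (Braid n)) (hPpos : Ppos = {α | α⁻¹ ∈ Pneg}) :
    (∀ α ∈ Ppos, ∀ β ∈ Ppos, α * β ∈ Ppos) ∧
    (∀ g₁ ∈ G₁b n, ∀ α ∈ Ppos, ∀ g₂ ∈ G₁b n, g₁ * α * g₂ ∈ Ppos) ∧
    (∀ α : Braid n, α ∈ Ppos ∨ α ∈ Pneg ∨ α ∈ G₁b n) ∧
    (∀ α : Braid n, ¬(α ∈ Ppos ∧ α ∈ Pneg)) ∧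
    (∀ α : Braid n, ¬(α ∈ Ppos ∧ α ∈ G₁b n)) ∧
    (∀ α : Braid n, ¬(α ∈ Pneg ∧ α ∈ G₁b n)) := by
  have hn0 : 0 < n := by omega
  have hneg : ∀ α, α ∈ Pneg ↔ α⁻¹ ∈ Spos n := fun α => by rw [hPneg]; exact negative_iff hn
  have hpos : ∀ α, α ∈ Ppos ↔ α ∈ Spos n := fun α => by
    rw [hPpos, Set.mem_ofPred_eq, hneg, inv_inv]
  simp only [hneg, hpos]
  refine ⟨fun α hα β hβ => Spos_mul_Sbar hα (Spos_subset_Sbar hβ),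
    fun g₁ h₁ α hα g₂ h₂ => Spos_mul_Sbar (Sbar_mul_Spos (mem_Sbar_of_G₁ h₁) hα)
      (mem_Sbar_of_G₁ h₂), mem_Spos_or hn,
    fun α h => inv_not_mem_Sbar hn0 h.1 (Spos_subset_Sbar h.2),
    fun α h => not_mem_G₁_of_mem_Spos hn0 h.1 h.2,
    fun α h => not_mem_G₁_of_mem_Spos hn0 h.1 (inv_mem h.2)⟩
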